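/- arXiv:1401.2452 — 3 statements merged into one kernel-verified Lean document; each statement's English description precedes it below -/
import Mathlib

section
/- For every dimension n ≥ 1 there exists a constant Δ(n) > 0 such that for any two disjoint nonempty compact subsets K, L of ℝⁿ there is a smooth function φ: ℝⁿ → [0,1] with φ⁻¹(0) = K, φ⁻¹(1) = L, and whose derivative has norm bounded everywhere by Δ(n)/d(K,L), where d(K,L) = inf{‖x−y‖ : x ∈ K, y ∈ L}. -/
open Metric MeasureTheory Set Function
open scoped ContDiff Convolution NNReal

section Smoothing

variable {E : Type*} [NormedAddCommGroup E] [NormedSpace ℝ E] [FiniteDimensional ℝ E]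

/-- Mollification of a Lipschitz function with values in `[0, 1]`: the Lipschitz constant and the
range are preserved, and so are the values at points near which the function is constant. -/
theorem LipschitzWith.exists_contDiff_lipschitzWith_mem_Icc {C : ℝ≥0} {g : E → ℝ}
    (hg : LipschitzWith C g) (hg01 : ∀ x, g x ∈ Icc (0 : ℝ) 1) {ε : ℝ} (hε : 0 < ε) :
    ∃ h : E → ℝ, ContDiff ℝ ∞ h ∧ LipschitzWith C h ∧ (∀ x, h x ∈ Icc (0 : ℝ) 1) ∧
      ∀ a, (∀ x ∈ ball a ε, g x = g a) → h a = g a := by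
  borelize E
  let μ : Measure E := .addHaar
  let ρ : ContDiffBump (0 : E) := ⟨ε / 2, ε, half_pos hε, half_lt_self hε⟩
  have hcont : Continuous g := hg.continuous
  refine ⟨ρ.normed μ ⋆[ContinuousLinearMap.lsmul ℝ ℝ, μ] g,
    ρ.hasCompactSupport_normed.contDiff_convolution_left _ ρ.contDiff_normed
      hcont.locallyIntegrable, ?_, fun x ↦ ?_, fun a ↦ ρ.normed_convolution_eq_right⟩
  · refine LipschitzWith.of_dist_le_mul fun x y ↦ ?_
    have hint (z : E) : Integrable (fun t ↦ ρ.normed μ t * g (z - t)) μ :=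
      (ρ.continuous_normed.mul (by fun_prop)).integrable_of_hasCompactSupport
        ρ.hasCompactSupport_normed.mul_right
    simp only [convolution_def, ContinuousLinearMap.lsmul_apply, smul_eq_mul]
    rw [dist_eq_norm, ← integral_sub (hint x) (hint y)]
    calc ‖∫ t, (ρ.normed μ t * g (x - t) - ρ.normed μ t * g (y - t)) ∂μ‖
        ≤ ∫ t, ρ.normed μ t * (C * dist x y) ∂μ := by
          refine norm_integral_le_of_norm_le (ρ.integrable_normed.mul_const _)
            (.of_forall fun t ↦ ?_)
          rw [← mul_sub, norm_mul, Real.norm_of_nonneg (ρ.nonneg_normed t), ← dist_eq_norm]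
          gcongr
          · exact ρ.nonneg_normed t
          · simpa using hg.dist_le_mul (x - t) (y - t)
      _ = C * dist x y := by rw [integral_mul_const, ρ.integral_normed, one_mul]
  · have key := dist_convolution_le (μ := μ) (x₀ := x) (z₀ := (1 / 2 : ℝ)) (ε := 1 / 2)
      (by norm_num) ρ.support_normed_eq.subset ρ.nonneg_normed ρ.integral_normed
      hcont.aestronglyMeasurable (fun y _ ↦ by
        rw [Real.dist_eq, abs_le]
        constructor <;> linarith [(hg01 y).1, (hg01 y).2])
    rw [Real.dist_eq, abs_le] at key
    constructor <;> linarith [key.1, key.2]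

/-- A compact set is the zero set of a smooth function with values in `[0, 1]` and bounded
derivative. -/
theorem IsCompact.exists_contDiff_zero_iff_norm_fderiv_le {K : Set E} (hK : IsCompact K) :
    ∃ a : E → ℝ, ContDiff ℝ ∞ a ∧ (∀ x, a x ∈ Icc (0 : ℝ) 1) ∧ (∀ x, a x = 0 ↔ x ∈ K) ∧
      ∃ A, ∀ x, ‖fderiv ℝ a x‖ ≤ A := by
  obtain ⟨f, hfs, hf, hf01⟩ := hK.isClosed.isOpen_compl.exists_contDiff_support_eq (n := ⊤)
  replace hf01 (x : E) : f x ∈ Icc (0 : ℝ) 1 := hf01 (mem_range_self x)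
  have hf0 (x : E) : f x = 0 ↔ x ∈ K := by
    rw [← notMem_support, hfs, notMem_compl_iff]
  obtain ⟨R, hR, hKR⟩ := hK.isBounded.subset_closedBall_lt 0 0
  let χ : ContDiffBump (0 : E) := ⟨R, R + 1, hR, lt_add_one R⟩
  have hu : ContDiff ℝ ∞ fun x ↦ χ x * (f x - 1) := χ.contDiff.mul (hf.sub contDiff_const)
  have huc : HasCompactSupport fun x ↦ χ x * (f x - 1) := χ.hasCompactSupport.mul_right
  refine ⟨fun x ↦ 1 + χ x * (f x - 1), contDiff_const.add hu, fun x ↦ ?_, fun x ↦ ?_, ?_⟩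
  · have h0 := χ.nonneg (x := x)
    have h1 := χ.le_one (x := x)
    constructor <;> nlinarith [(hf01 x).1, (hf01 x).2]
  · rw [← hf0]
    refine ⟨fun h ↦ ?_, fun h ↦ ?_⟩
    · have h0 := χ.nonneg (x := x)
      have h1 := χ.le_one (x := x)
      nlinarith [(hf01 x).1, (hf01 x).2]
    · beta_reduce
      rw [h, χ.one_of_mem_closedBall (hKR ((hf0 x).1 h))]
      norm_num
  · obtain ⟨A, hA⟩ := (huc.fderiv ℝ).exists_bound_of_continuous (hu.continuous_fderiv (by simp))
    exact ⟨A, fun x ↦ by simpa only [fderiv_const_add] using hA x⟩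

/-- If `K` and `L` are at distance at least `d > 0`, there is a smooth `2 / d`-Lipschitz function
with values in `[0, 1]` vanishing on `K` and equal to `1` on `L`. -/
theorem exists_contDiff_lipschitzWith_eq_zero_eq_one {K L : Set E} (hK : K.Nonempty) {d : ℝ≥0}
    (hd : 0 < d) (hKL : ∀ x ∈ K, ∀ y ∈ L, d ≤ dist x y) :
    ∃ h : E → ℝ, ContDiff ℝ ∞ h ∧ LipschitzWith (2 / d) h ∧ (∀ x, h x ∈ Icc (0 : ℝ) 1) ∧
      (∀ x ∈ K, h x = 0) ∧ ∀ x ∈ L, h x = 1 := by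
  have hd' : (0 : ℝ) < d := hd
  let g : E → ℝ := fun x ↦ max 0 (min 1 (2 / d * infDist x K - 1 / 2))
  have hg : LipschitzWith (2 / d) g := by
    refine LipschitzWith.const_max (LipschitzWith.const_min (.of_dist_le_mul fun x y ↦ ?_) _) _
    have h := (lipschitz_infDist_pt K).dist_le_mul x y
    rw [dist_sub_right, Real.dist_eq, ← mul_sub, abs_mul, abs_of_pos (by positivity)]
    push_cast
    gcongr
    simpa [Real.dist_eq] using h
  have hg01 (x : E) : g x ∈ Icc (0 : ℝ) 1 :=
    ⟨le_max_left _ _, max_le zero_le_one (min_le_left _ _)⟩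
  have hgK : ∀ x ∈ K, ∀ y ∈ ball x (d / 4 : ℝ), g y = 0 := fun x hx y hy ↦ by
    have h : infDist y K ≤ d / 4 := (infDist_le_dist_of_mem hx).trans (mem_ball.1 hy).le
    have : 2 / d * infDist y K ≤ 2 / d * (d / 4 : ℝ) := by gcongr
    have e : 2 / d * (d / 4 : ℝ) = 1 / 2 := by field_simp; norm_num
    exact max_eq_left ((min_le_right _ _).trans (by linarith))
  have hgL : ∀ x ∈ L, ∀ y ∈ ball x (d / 4 : ℝ), g y = 1 := fun x hx y hy ↦ by
    have h : 3 * d / 4 ≤ infDist y K := by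
      refine (le_infDist hK).2 fun z hz ↦ ?_
      have := hKL z hz x hx
      have := dist_triangle z y x
      rw [dist_comm z y] at this
      linarith [mem_ball.1 hy]
    have : 2 / d * (3 * d / 4 : ℝ) ≤ 2 / d * infDist y K := by gcongr
    have e : 2 / d * (3 * d / 4 : ℝ) = 3 / 2 := by field_simp; norm_num
    have : min 1 (2 / d * infDist y K - 1 / 2) = 1 := min_eq_left (by linarith)
    simp only [g, this, zero_le_one, max_eq_right]
  have hd4 : (0 : ℝ) < d / 4 := by positivity
  obtain ⟨h, hh, hl, h01, heq⟩ := hg.exists_contDiff_lipschitzWith_mem_Icc hg01 hd4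
  refine ⟨h, hh, hl, h01, fun x hx ↦ ?_, fun x hx ↦ ?_⟩
  · have hx' := hgK x hx x (mem_ball_self hd4)
    rw [heq x fun y hy ↦ (hgK x hx y hy).trans hx'.symm, hx']
  · have hx' := hgL x hx x (mem_ball_self hd4)
    rw [heq x fun y hy ↦ (hgL x hx y hy).trans hx'.symm, hx']

/-- Compact sets at distance at least `d > 0` are exactly the zero set and the one set of a smooth
function with values in `[0, 1]` whose derivative is bounded by `3 / d`. -/
theorem IsCompact.exists_contDiff_zero_iff_one_iff_norm_fderiv_le {K L : Set E} (hK : IsCompact K)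
    (hL : IsCompact L) (hKne : K.Nonempty) {d : ℝ≥0} (hd : 0 < d)
    (hKL : ∀ x ∈ K, ∀ y ∈ L, d ≤ dist x y) :
    ∃ φ : E → ℝ, ContDiff ℝ ∞ φ ∧ (∀ x, φ x ∈ Icc (0 : ℝ) 1) ∧ (∀ x, φ x = 0 ↔ x ∈ K) ∧
      (∀ x, φ x = 1 ↔ x ∈ L) ∧ ∀ x, ‖fderiv ℝ φ x‖ ≤ 3 / d := by
  have hd' : (0 : ℝ) < d := hd
  obtain ⟨h, hh, hl, h01, hK0, hL1⟩ := exists_contDiff_lipschitzWith_eq_zero_eq_one hKne hd hKL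
  obtain ⟨a, ha, ha01, ha0, A, hA⟩ := hK.exists_contDiff_zero_iff_norm_fderiv_le
  obtain ⟨b, hb, hb01, hb0, B, hB⟩ := hL.exists_contDiff_zero_iff_norm_fderiv_le
  have hdh (x : E) : ‖fderiv ℝ h x‖ ≤ 2 / d := by
    simpa using norm_fderiv_le_of_lipschitz ℝ (x₀ := x) hl
  have hA0 : 0 ≤ A := (norm_nonneg _).trans (hA 0)
  have hB0 : 0 ≤ B := (norm_nonneg _).trans (hB 0)
  let ψ : E → ℝ := fun x ↦ a x - h x * (a x + b x)
  let M : ℝ := A + (1 * (A + B) + 2 * (2 / d))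
  have hM : 0 < M := by positivity
  have hψ (x : E) : ‖fderiv ℝ ψ x‖ ≤ M := by
    have hha := (ha.differentiable (by simp) x).hasFDerivAt
    have hhb := (hb.differentiable (by simp) x).hasFDerivAt
    have hhh := (hh.differentiable (by simp) x).hasFDerivAt
    rw [(hha.fun_sub (hhh.fun_mul (hha.fun_add hhb))).fderiv]
    refine (norm_sub_le _ _).trans (add_le_add (hA x) ((norm_add_le _ _).trans
      (add_le_add ?_ ?_)))
    · rw [norm_smul, Real.norm_of_nonneg (h01 x).1]
      gcongr
      · exact (h01 x).2
      · exact (norm_add_le _ _).trans (add_le_add (hA x) (hB x))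
    · have hab : 0 ≤ a x + b x := add_nonneg (ha01 x).1 (hb01 x).1
      rw [norm_smul, Real.norm_of_nonneg hab]
      gcongr
      · linarith [(ha01 x).2, (hb01 x).2]
      · exact hdh x
  obtain ⟨ε, hε, hε'⟩ : ∃ ε : ℝ, 0 < ε ∧ ε ≤ min (1 / 2) (1 / d / M) :=
    ⟨_, by positivity, le_rfl⟩
  have hε2 : ε ≤ 1 / 2 := hε'.trans (min_le_left _ _)
  have hεM : ε * M ≤ 1 / d := (le_div_iff₀ hM).1 (hε'.trans (min_le_right _ _))
  have hψs : ContDiff ℝ ∞ ψ := ha.sub (hh.mul (ha.add hb))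
  have e0 (x : E) : h x + ε * ψ x = ε * a x * (1 - h x) + h x * (1 - ε * b x) := by
    simp only [ψ]; ring
  have e1 (x : E) : 1 - (h x + ε * ψ x) = ε * b x * h x + (1 - h x) * (1 - ε * a x) := by
    simp only [ψ]; ring
  have hεa (x : E) : 0 < 1 - ε * a x := by nlinarith [(ha01 x).1, (ha01 x).2]
  have hεb (x : E) : 0 < 1 - ε * b x := by nlinarith [(hb01 x).1, (hb01 x).2]
  have p1 (x : E) : 0 ≤ ε * a x * (1 - h x) :=
    mul_nonneg (mul_nonneg hε.le (ha01 x).1) (sub_nonneg.2 (h01 x).2)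
  have p2 (x : E) : 0 ≤ h x * (1 - ε * b x) := mul_nonneg (h01 x).1 (hεb x).le
  have p3 (x : E) : 0 ≤ ε * b x * h x := mul_nonneg (mul_nonneg hε.le (hb01 x).1) (h01 x).1
  have p4 (x : E) : 0 ≤ (1 - h x) * (1 - ε * a x) :=
    mul_nonneg (sub_nonneg.2 (h01 x).2) (hεa x).le
  refine ⟨fun x ↦ h x + ε * ψ x, hh.add (contDiff_const.mul hψs), fun x ↦ ⟨?_, ?_⟩,
    fun x ↦ ⟨fun hx ↦ ?_, fun hx ↦ ?_⟩, fun x ↦ ⟨fun hx ↦ ?_, fun hx ↦ ?_⟩, fun x ↦ ?_⟩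
  · linarith [e0 x, p1 x, p2 x]
  · linarith [e1 x, p3 x, p4 x]
  · have hhx : h x = 0 :=
      (mul_eq_zero.1 (by linarith [e0 x, p1 x, p2 x])).resolve_right (hεb x).ne'
    have hax : ε * a x = 0 := by
      simpa [hhx, ψ] using hx
    exact (ha0 x).1 ((mul_eq_zero.1 hax).resolve_left hε.ne')
  · simp [ψ, hK0 x hx, (ha0 x).2 hx]
  · have hhx : 1 - h x = 0 :=
      (mul_eq_zero.1 (by linarith [e1 x, p3 x, p4 x])).resolve_right (hεa x).ne'
    have hbx : ε * b x = 0 := by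
      simpa [← sub_eq_zero.1 hhx, ψ] using hx
    exact (hb0 x).1 ((mul_eq_zero.1 hbx).resolve_left hε.ne')
  · simp [ψ, hL1 x hx, (hb0 x).2 hx]
  · have hhh := (hh.differentiable (by simp) x).hasFDerivAt
    have hhψ := (hψs.differentiable (by simp) x).hasFDerivAt
    rw [(hhh.fun_add (hhψ.const_mul ε)).fderiv]
    calc _ ≤ ‖fderiv ℝ h x‖ + ‖ε • fderiv ℝ ψ x‖ := norm_add_le _ _
      _ ≤ 2 / d + ε * M := by
        rw [norm_smul, Real.norm_of_nonneg hε.le]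
        gcongr
        · exact hdh x
        · exact hψ x
      _ ≤ 2 / d + 1 / d := by gcongr
      _ = 3 / d := by ring

end Smoothing


/-- Lemma `l.smoothing`: for every `n ≥ 1` there is a constant `Δ(n) > 0` such that any two
disjoint nonempty compact subsets `K, L ⊆ ℝⁿ` are separated by a smooth function
`φ : ℝⁿ → [0,1]` with `φ⁻¹(0) = K`, `φ⁻¹(1) = L`, whose derivative is bounded by
`Δ(n) / d(K,L)`. -/
theorem stmt_0 (n : ℕ) (hn : 1 ≤ n) :
    ∃ Δ : ℝ, 0 < Δ ∧
      ∀ K L : Set (EuclideanSpace ℝ (Fin n)),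
        IsCompact K → IsCompact L → K.Nonempty → L.Nonempty → Disjoint K L →
        ∃ φ : EuclideanSpace ℝ (Fin n) → ℝ,
          ContDiff ℝ (⊤ : ℕ∞) φ ∧
          (∀ x, φ x ∈ Set.Icc (0 : ℝ) 1) ∧
          φ ⁻¹' {0} = K ∧
          φ ⁻¹' {1} = L ∧
          ∀ x, ‖fderiv ℝ φ x‖ ≤ Δ / sInf {d : ℝ | ∃ x ∈ K, ∃ y ∈ L, d = dist x y} := by
  refine ⟨3, by norm_num, fun K L hK hL hKne hLne hdisj ↦ ?_⟩
  set S : Set ℝ := {d : ℝ | ∃ x ∈ K, ∃ y ∈ L, d = dist x y} with hS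
  have hSeq : S = (fun p : _ × _ ↦ dist p.1 p.2) '' (K ×ˢ L) := by
    ext d
    simp only [hS, mem_ofPred_eq, mem_image, mem_prod, Prod.exists]
    constructor
    · rintro ⟨x, hx, y, hy, rfl⟩
      exact ⟨x, y, ⟨hx, hy⟩, rfl⟩
    · rintro ⟨x, y, ⟨hx, hy⟩, rfl⟩
      exact ⟨x, hx, y, hy, rfl⟩
  have hSc : IsCompact S := hSeq ▸ (hK.prod hL).image continuous_dist
  have hSne : S.Nonempty := hSeq ▸ (hKne.prod hLne).image _
  have hpos : 0 < sInf S := by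
    obtain ⟨x, hx, y, hy, hxy⟩ := hSc.sInf_mem hSne
    rw [hxy]
    exact dist_pos.2 (hdisj.ne_of_mem hx hy)
  obtain ⟨φ, hφ, h01, h0, h1, hfd⟩ :=
    hK.exists_contDiff_zero_iff_one_iff_norm_fderiv_le hL hKne (d := ⟨sInf S, hpos.le⟩) hpos
      fun x hx y hy ↦ csInf_le hSc.bddBelow ⟨x, hx, y, hy, rfl⟩
  exact ⟨φ, hφ, h01, ext h0, ext h1, hfd⟩
end

section
/- Let K ⊂ ℝⁿ be a compact set such that (i) every vertical (n−d)-dimensional affine subspace {x} × ℝ^{n−d} (for x ∈ ℝ^d) meets K in at most one point, (ii) for every p ∈ K there is a d-dimensional linear subspace E(p) ⊂ ℝⁿ, transverse to {0}^d × ℝ^{n−d}, containing the tangent set of K at p, and (iii) p ↦ E(p) is continuous on K. Then K is contained in the graph Γ of a C¹ map Φ: ℝ^d → ℝ^{n−d}, and the tangent space of Γ at each point p of K equals E(p). -/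
open Metric

/-- The tangent set of `K` at `z`: the set of directions `v` that are, for every `ε > 0`,
limits of normalized differences of distinct points of `K` in the `ε`-ball around `z`. -/
def tangentDirections {W : Type*} [NormedAddCommGroup W] [NormedSpace ℝ W]
    (K : Set W) (z : W) : Set W :=
  {v | ∀ ε > (0 : ℝ), v ∈ closure
    {w | ∃ x ∈ K ∩ ball z ε, ∃ y ∈ K ∩ ball z ε, x ≠ y ∧ w = ‖x - y‖⁻¹ • (x - y)}}

/-- The tangent set `T_zK`: the linear span of the limit directions. -/
def tangentSet {W : Type*} [NormedAddCommGroup W] [NormedSpace ℝ W]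
    (K : Set W) (z : W) : Submodule ℝ W :=
  Submodule.span ℝ (tangentDirections K z)

section Whitney

open MeasureTheory Set Filter Topology

variable {E : Type*} [NormedAddCommGroup E] [NormedSpace ℝ E]

/-- A Whitney-type condition for the `1`-jet `(f, L)` on a compact set yields a Lipschitz gauge `φ`
controlling the Taylor remainder, with arbitrarily small Lipschitz constant near `0`. -/
theorem exists_remainder_gauge {A : Set E} (hA : IsCompact A) {f : E → ℝ} {L : E → E →L[ℝ] ℝ}
    (hf : ContinuousOn f A) (hL : ContinuousOn L A)
    (hw : ∀ η > 0, ∃ δ > 0, ∀ x ∈ A, ∀ y ∈ A, ‖x - y‖ < δ →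
      |f x - f y - L y (x - y)| ≤ η * ‖x - y‖) :
    ∃ (φ : ℝ → ℝ) (M : ℝ), 0 ≤ M ∧ φ 0 = 0 ∧
      (∀ s t, 0 ≤ s → 0 ≤ t → |φ s - φ t| ≤ M * |s - t|) ∧
      (∀ η > 0, ∃ T > 0, ∀ s t, 0 ≤ s → 0 ≤ t → s < T → t < T → |φ s - φ t| ≤ η * |s - t|) ∧
      (∀ x ∈ A, ∀ y ∈ A, |f x - f y - L y (x - y)| + ‖x - y‖ * min ‖x - y‖ 1 ≤ φ ‖x - y‖) := by
  obtain ⟨Bf, hBf⟩ := hA.exists_bound_of_continuousOn hf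
  obtain ⟨BL, hBL⟩ := hA.exists_bound_of_continuousOn hL
  -- a global linear bound for the remainder
  obtain ⟨C, hC0, hC⟩ : ∃ C : ℝ, 0 ≤ C ∧ ∀ x ∈ A, ∀ y ∈ A,
      |f x - f y - L y (x - y)| ≤ C * ‖x - y‖ := by
    obtain ⟨δ, hδ, h1⟩ := hw 1 one_pos
    refine ⟨1 + 2 * |Bf| / δ + |BL|, by positivity, fun x hx y hy => ?_⟩
    rcases lt_or_ge ‖x - y‖ δ with h | h
    · refine (h1 x hx y hy h).trans ?_
      gcongr
      have : 0 ≤ 2 * |Bf| / δ := by positivity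
      linarith [abs_nonneg BL]
    · have e1 : |f x| ≤ |Bf| := (hBf x hx).trans (le_abs_self _)
      have e2 : |f y| ≤ |Bf| := (hBf y hy).trans (le_abs_self _)
      have e3 : |L y (x - y)| ≤ |BL| * ‖x - y‖ := by
        refine ((L y).le_opNorm _).trans ?_
        gcongr
        exact (hBL y hy).trans (le_abs_self _)
      have e4 : 2 * |Bf| ≤ 2 * |Bf| / δ * ‖x - y‖ := by
        rw [div_mul_eq_mul_div, le_div_iff₀ hδ]
        gcongr
      have e5 := abs_sub (f x - f y) (L y (x - y))
      have e6 := abs_sub (f x) (f y)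
      nlinarith [norm_nonneg (x - y)]
  -- the modulus
  let S : ℝ → Set ℝ := fun t => {η | 0 ≤ η ∧ ∀ x ∈ A, ∀ y ∈ A, ‖x - y‖ ≤ t →
      |f x - f y - L y (x - y)| ≤ η * ‖x - y‖}
  have hCS : ∀ t, C ∈ S t := fun t => ⟨hC0, fun x hx y hy _ => hC x hx y hy⟩
  have hSb : ∀ t, BddBelow (S t) := fun t => ⟨0, fun η h => h.1⟩
  let ω : ℝ → ℝ := fun t => sInf (S t) + min (max t 0) 1
  have hω0 : ∀ t, 0 ≤ ω t := fun t =>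
    add_nonneg (le_csInf ⟨C, hCS t⟩ fun η h => h.1) (by positivity)
  have hωC : ∀ t, ω t ≤ C + 1 := fun t =>
    add_le_add (csInf_le (hSb t) (hCS t)) (min_le_right _ _)
  have hmono : Monotone ω := by
    intro s t hst
    refine add_le_add (csInf_le_csInf (hSb s) ⟨C, hCS t⟩ ?_) (by gcongr)
    exact fun η h => ⟨h.1, fun x hx y hy hxy => h.2 x hx y hy (hxy.trans hst)⟩
  have hint : ∀ a b, IntervalIntegrable ω volume a b := fun a b => hmono.intervalIntegrable
  have hdiff : ∀ s t, (∫ u in (0:ℝ)..(2 * s), ω u) - (∫ u in (0:ℝ)..(2 * t), ω u)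
      = ∫ u in (2 * t)..(2 * s), ω u := fun s t =>
    intervalIntegral.integral_interval_sub_left (hint _ _) (hint _ _)
  have hlip : ∀ s t N, (∀ u ≤ max (2 * s) (2 * t), ω u ≤ N) →
      |(∫ u in (0:ℝ)..(2 * s), ω u) - (∫ u in (0:ℝ)..(2 * t), ω u)| ≤ 2 * N * |s - t| := by
    intro s t N hN
    rw [hdiff]
    have := intervalIntegral.norm_integral_le_of_norm_le_const (a := 2 * t) (b := 2 * s) (C := N)
      (f := ω) (fun u hu => by
        rw [Real.norm_of_nonneg (hω0 u)]
        refine hN u ?_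
        rw [max_comm]
        exact hu.2)
    rw [Real.norm_eq_abs, ← mul_sub, abs_mul, abs_two] at this
    linarith
  refine ⟨fun t => ∫ u in (0:ℝ)..(2 * t), ω u, 2 * (C + 1), by positivity, by simp, ?_, ?_, ?_⟩
  · exact fun s t _ _ => hlip s t _ fun u _ => hωC u
  · intro η hη
    obtain ⟨δ, hδ, h1⟩ := hw (η / 4) (by positivity)
    refine ⟨min δ (η / 4) / 2, by positivity, fun s t hs ht hsT htT => ?_⟩
    have := hlip s t (η / 2) fun u hu => by
      have hu' : u < min δ (η / 4) := by
        refine hu.trans_lt (max_lt ?_ ?_) <;> linarith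
      have i1 : sInf (S u) ≤ η / 4 := csInf_le (hSb u)
        ⟨by positivity, fun x hx y hy hxy => h1 x hx y hy
          (hxy.trans_lt (hu'.trans_le (min_le_left _ _)))⟩
      have i2 : min (max u 0) 1 ≤ η / 4 := (min_le_left _ _).trans
        (max_le (hu'.le.trans (min_le_right _ _)) (by positivity))
      change sInf (S u) + min (max u 0) 1 ≤ η / 2
      linarith
    linarith
  · intro x hx y hy
    set t := ‖x - y‖ with ht
    have ht0 : 0 ≤ t := norm_nonneg _
    have j1 : |f x - f y - L y (x - y)| + t * min t 1 ≤ t * ω t := by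
      have : |f x - f y - L y (x - y)| ≤ sInf (S t) * t := by
        rcases ht0.eq_or_lt with h0 | h0
        · have := hC x hx y hy
          rw [← ht, ← h0] at this
          rw [← h0]; linarith
        · rw [← div_le_iff₀ h0]
          refine le_csInf ⟨C, hCS t⟩ fun η h => ?_
          rw [div_le_iff₀ h0]
          exact h.2 x hx y hy le_rfl
      change _ ≤ t * (sInf (S t) + min (max t 0) 1)
      rw [max_eq_left ht0]
      linarith
    have j2 : t * ω t ≤ ∫ u in t..(2 * t), ω u := by
      have := intervalIntegral.integral_mono_on (a := t) (b := 2 * t) (f := fun _ => ω t) (g := ω)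
        (μ := volume) (by linarith) intervalIntegrable_const (hint _ _) fun u hu => hmono hu.1
      simp only [intervalIntegral.integral_const, smul_eq_mul] at this
      linarith
    have j3 : 0 ≤ ∫ u in (0:ℝ)..t, ω u :=
      intervalIntegral.integral_nonneg ht0 fun u _ => hω0 u
    have j4 := intervalIntegral.integral_add_adjacent_intervals (hint 0 t) (hint t (2 * t))
    change _ ≤ ∫ u in (0:ℝ)..(2 * t), ω u
    linarith

/-- A Whitney `1`-jet on a compact set extends to a continuous function which is, near each
point `p` of the set, a small Lipschitz perturbation of the linear map `L p`. -/
theorem exists_continuous_extension_nearly_linear {A : Set E} (hA : IsCompact A)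
    (hne : A.Nonempty) {f : E → ℝ} {L : E → E →L[ℝ] ℝ}
    (hf : ContinuousOn f A) (hL : ContinuousOn L A)
    (hw : ∀ η > 0, ∃ δ > 0, ∀ x ∈ A, ∀ y ∈ A, ‖x - y‖ < δ →
      |f x - f y - L y (x - y)| ≤ η * ‖x - y‖) :
    ∃ F : E → ℝ, Continuous F ∧ EqOn F f A ∧
      ∀ p ∈ A, ∀ η > 0, ∃ δ > 0, ∀ x ∈ ball p δ, ∀ x' ∈ ball p δ,
        |F x - F x' - L p (x - x')| ≤ η * ‖x - x'‖ := by
  obtain ⟨φ, M₀, hM₀, hφ0, hφM, hφη, hφR⟩ := exists_remainder_gauge hA hf hL hw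
  obtain ⟨BL, hBL⟩ := hA.exists_bound_of_continuousOn hL
  let g : E → E → ℝ := fun y x => f y + L y (x - y) + φ ‖x - y‖
  obtain ⟨M, hM, hgM⟩ : ∃ M : ℝ, 0 < M ∧ ∀ y ∈ A, ∀ x x', g y x - g y x' ≤ M * ‖x - x'‖ := by
    refine ⟨|BL| + M₀ + 1, by positivity, fun y hy x x' => ?_⟩
    have h1 : L y (x - x') ≤ |BL| * ‖x - x'‖ := by
      refine (le_abs_self _).trans (((L y).le_opNorm _).trans ?_)
      gcongr
      exact (hBL y hy).trans (le_abs_self _)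
    have h2 := (le_abs_self _).trans (hφM ‖x - y‖ ‖x' - y‖ (norm_nonneg _) (norm_nonneg _))
    have h3 := abs_norm_sub_norm_le (x - y) (x' - y)
    rw [sub_sub_sub_cancel_right] at h3
    have h4 : L y (x - x') = L y (x - y) - L y (x' - y) := by
      rw [← map_sub, sub_sub_sub_cancel_right]
    change f y + L y (x - y) + φ ‖x - y‖ - (f y + L y (x' - y) + φ ‖x' - y‖) ≤ _
    nlinarith [mul_le_mul_of_nonneg_left h3 hM₀, norm_nonneg (x - x')]
  have hgself : ∀ y, g y y = f y := fun y => by simp [g, hφ0]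
  have hgsep : ∀ y ∈ A, ∀ p ∈ A, f p + ‖p - y‖ * min ‖p - y‖ 1 ≤ g y p := by
    intro y hy p hp
    have := hφR p hp y hy
    have h2 := le_abs_self (f p - f y - L y (p - y))
    change _ ≤ f y + L y (p - y) + φ ‖p - y‖
    linarith
  have hgge : ∀ y ∈ A, ∀ p ∈ A, f p ≤ g y p := fun y hy p hp => by
    have := hgsep y hy p hp
    have : 0 ≤ ‖p - y‖ * min ‖p - y‖ 1 := by positivity
    linarith
  have : Nonempty A := hne.to_subtype
  obtain ⟨p₀, hp₀⟩ := hne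
  let F : E → ℝ := fun x => ⨅ y : A, g y x
  have hbdd : ∀ x, BddBelow (range fun y : A => g y x) := by
    refine fun x => ⟨f p₀ - M * ‖p₀ - x‖, ?_⟩
    rintro _ ⟨y, rfl⟩
    have h1 := hgM y y.2 p₀ x
    have h2 := hgge y y.2 p₀ hp₀
    change _ ≤ g y x
    linarith
  have hFle : ∀ x, ∀ y ∈ A, F x ≤ g y x := fun x y hy => ciInf_le (hbdd x) ⟨y, hy⟩
  have hFM : ∀ x x', F x - F x' ≤ M * ‖x - x'‖ := by
    intro x x'
    rw [sub_le_comm]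
    refine le_ciInf fun y => ?_
    have h1 := hgM y y.2 x x'
    have h2 := hFle x y y.2
    linarith
  refine ⟨F, ?_, ?_, ?_⟩
  · refine (LipschitzWith.of_le_add_mul ⟨M, hM.le⟩ fun x x' => ?_).continuous
    have := hFM x x'
    rw [← dist_eq_norm] at this
    change F x ≤ F x' + M * dist x x'
    linarith
  · intro p hp
    exact le_antisymm ((hFle p p hp).trans_eq (hgself p)) (le_ciInf fun y => hgge y y.2 p hp)
  · intro p hp η hη
    obtain ⟨T, hT, hφT⟩ := hφη (η / 2) (by positivity)
    obtain ⟨ρ₀, hρ₀, hLρ⟩ := Metric.continuousOn_iff.1 hL p hp (η / 2) (by positivity)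
    obtain ⟨ρ, hρ, hρρ₀, hρT⟩ : ∃ ρ > 0, ρ ≤ ρ₀ ∧ ρ ≤ T / 2 :=
      ⟨min ρ₀ (T / 2), by positivity, min_le_left _ _, min_le_right _ _⟩
    obtain ⟨δ, hδ, hδT, hδM⟩ : ∃ δ > 0, δ ≤ T / 2 ∧ 2 * M * δ ≤ ρ * min ρ 1 := by
      refine ⟨min (T / 2) (ρ * min ρ 1 / (2 * M)), by positivity, min_le_left _ _, ?_⟩
      calc 2 * M * min (T / 2) (ρ * min ρ 1 / (2 * M))
          ≤ 2 * M * (ρ * min ρ 1 / (2 * M)) := by gcongr; exact min_le_right _ _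
        _ = _ := by field_simp
    have hnear : ∀ y ∈ A, ‖p - y‖ < ρ → ∀ x ∈ ball p δ, ∀ x' ∈ ball p δ,
        g y x - g y x' - L p (x - x') ≤ η * ‖x - x'‖ := by
      intro y hy hyp x hx x' hx'
      rw [mem_ball, dist_eq_norm] at hx hx'
      have a1 := norm_sub_le_norm_sub_add_norm_sub x p y
      have a2 := norm_sub_le_norm_sub_add_norm_sub x' p y
      have h2 := (le_abs_self _).trans (hφT ‖x - y‖ ‖x' - y‖ (norm_nonneg _) (norm_nonneg _)
        (by linarith) (by linarith))
      have h3 := abs_norm_sub_norm_le (x - y) (x' - y)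
      rw [sub_sub_sub_cancel_right] at h3
      have h1 : (L y - L p) (x - x') ≤ η / 2 * ‖x - x'‖ := by
        refine (le_abs_self _).trans (((L y - L p).le_opNorm _).trans ?_)
        gcongr
        rw [← dist_eq_norm]
        refine (hLρ y hy ?_).le
        rw [dist_comm, dist_eq_norm]
        linarith
      have h4 : L y (x - x') = L y (x - y) - L y (x' - y) := by
        rw [← map_sub, sub_sub_sub_cancel_right]
      rw [sub_apply] at h1
      change f y + L y (x - y) + φ ‖x - y‖ - (f y + L y (x' - y) + φ ‖x' - y‖) - _ ≤ _
      nlinarith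
    have hone : ∀ x ∈ ball p δ, ∀ x' ∈ ball p δ,
        F x - F x' - L p (x - x') ≤ η * ‖x - x'‖ := by
      intro x hx x' hx'
      suffices F x - L p (x - x') - η * ‖x - x'‖ ≤ F x' by linarith
      refine le_ciInf fun y => ?_
      obtain ⟨y, hy⟩ := y
      change _ ≤ g y x'
      rcases lt_or_ge ‖p - y‖ ρ with h | h
      · have := hnear y hy h x hx x' hx'
        have := hFle x y hy
        linarith
      · have h1 := hnear p hp (by simpa using hρ) x hx x' hx'
        have h2 := hFle x p hp
        have h3 := hgM y hy p x'
        have h4 := hgM p hp x' p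
        have h5 := hgsep y hy p hp
        have h6 : ρ * min ρ 1 ≤ ‖p - y‖ * min ‖p - y‖ 1 := by gcongr
        have h7 := hgself p
        rw [mem_ball, dist_eq_norm] at hx'
        rw [norm_sub_rev] at h3
        nlinarith
    refine ⟨δ, hδ, fun x hx x' hx' => abs_le.2 ⟨?_, hone x hx x' hx'⟩⟩
    have := hone x' hx' x hx
    rw [norm_sub_rev, ← neg_sub x x', map_neg] at this
    linarith

/-- Averaging a continuous function over balls of smoothly varying positive radius
gives a `C¹` function. -/
theorem contDiffAt_integral_mul_comp_sub_smul [FiniteDimensional ℝ E] [MeasurableSpace E]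
    [BorelSpace E] (μ : Measure E) [μ.IsAddHaarMeasure] {F : E → ℝ} (hF : Continuous F)
    {ψ : E → ℝ} (hψ : ContDiff ℝ 1 ψ) (hψ0 : ∀ z, z ∉ closedBall (0 : E) 1 → ψ z = 0)
    {r : E → ℝ} (hr : ContDiff ℝ 1 r) {x : E} (hx : 0 < r x) :
    ContDiffAt ℝ 1 (fun x => ∫ z, ψ z * F (x - r x • z) ∂μ) x := by
  let n := Module.finrank ℝ E
  let g : ℝ → E → ℝ := fun s u => (s ^ n)⁻¹ * ψ (s⁻¹ • u)
  obtain ⟨R, hR⟩ := exists_gt (r x)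
  have hconv := contDiffOn_convolution_right_with_param (μ := μ) (n := 1)
    (ContinuousLinearMap.mul ℝ ℝ) (f := F) (g := g) (s := Ioo 0 R) (k := closedBall 0 R) isOpen_Ioo
    (isCompact_closedBall 0 R) (fun s u hs hu => by
      refine mul_eq_zero_of_right _ (hψ0 _ fun h => hu ?_)
      rw [mem_closedBall_zero_iff] at h ⊢
      rw [norm_smul, norm_inv, Real.norm_of_nonneg hs.1.le, inv_mul_le_iff₀ hs.1, mul_one] at h
      exact h.trans hs.2.le) hF.locallyIntegrable (by
      have h1 : ContDiffOn ℝ 1 (fun q : ℝ × E => q.1⁻¹) (Ioo 0 R ×ˢ univ) :=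
        contDiffOn_fst.inv fun q hq => hq.1.1.ne'
      have h2 : ContDiffOn ℝ 1 (fun q : ℝ × E => (q.1 ^ n)⁻¹) (Ioo 0 R ×ˢ univ) :=
        (contDiffOn_fst.pow n).inv fun q hq => (pow_pos hq.1.1 n).ne'
      exact h2.mul (hψ.comp_contDiffOn (h1.smul contDiffOn_snd)))
  have hat := (hconv.contDiffAt ((isOpen_Ioo.prod isOpen_univ).mem_nhds
    (show (r x, x) ∈ Ioo 0 R ×ˢ univ from ⟨⟨hx, hR⟩, mem_univ _⟩))).comp (f := fun y => (r y, y)) x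
    (hr.contDiffAt.prodMk contDiffAt_id)
  refine hat.congr_of_eventuallyEq ?_
  filter_upwards [hr.continuous.continuousAt.eventually (lt_mem_nhds hx)] with y hy
  have e1 := integral_sub_left_eq_self (fun t => F t * g (r y) (y - t)) μ y
  have e2 := Measure.integral_comp_inv_smul_of_nonneg μ
    (fun z => ψ z * F (y - r y • z)) (R := r y) hy.le
  simp only [sub_sub_cancel, smul_inv_smul₀ hy.ne'] at e1 e2
  simp only [Function.comp_apply, convolution_def, ContinuousLinearMap.mul_apply']
  rw [← e1]
  have hne : r y ^ n ≠ 0 := (pow_pos hy n).ne'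
  have e3 : ∀ u, F (y - u) * g (r y) u = (r y ^ n)⁻¹ * (ψ ((r y)⁻¹ • u) * F (y - u)) := fun u => by
    simp only [g]; ring
  simp only [e3]
  rw [integral_const_mul, e2, smul_eq_mul, inv_mul_cancel_left₀ hne]

/-- A continuous function which near each point `p` of a closed set `A` is a small Lipschitz
perturbation of the linear map `L p` can be made `C¹` without changing it on `A`. -/
theorem exists_contDiff_eqOn_of_nearly_linear [FiniteDimensional ℝ E] {A : Set E}
    (hA : IsClosed A) {F : E → ℝ} {L : E → E →L[ℝ] ℝ} (hF : Continuous F)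
    (hFL : ∀ p ∈ A, ∀ η > 0, ∃ δ > 0, ∀ x ∈ ball p δ, ∀ x' ∈ ball p δ,
      |F x - F x' - L p (x - x')| ≤ η * ‖x - x'‖) :
    ∃ Φ : E → ℝ, ContDiff ℝ 1 Φ ∧ EqOn Φ F A ∧ ∀ p ∈ A, HasFDerivAt Φ (L p) p := by
  borelize E
  let μ : Measure E := Measure.addHaar
  obtain ⟨r, hrA, hr, hr01⟩ := hA.isOpen_compl.exists_contDiff_support_eq (n := 1)
  have hr0 : ∀ x, 0 ≤ r x := fun x => (hr01 (mem_range_self x)).1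
  have hrz : ∀ p ∈ A, r p = 0 := fun p hp => by
    by_contra h
    have : p ∈ Aᶜ := hrA ▸ h
    exact this hp
  have hrpos : ∀ p, p ∉ A → 0 < r p := fun p hp =>
    (hr0 p).lt_of_ne' (by have : p ∈ Function.support r := hrA ▸ hp
                          exact this)
  let b : ContDiffBump (0 : E) := ⟨1 / 2, 1, by norm_num, by norm_num⟩
  let ψ : E → ℝ := b.normed μ
  have hψs : ∀ z, z ∉ closedBall (0 : E) 1 → ψ z = 0 := by
    intro z hz
    by_contra h
    have : z ∈ Function.support (b.normed μ) := h
    rw [b.support_normed_eq] at this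
    exact hz (ball_subset_closedBall this)
  have hψ1 : ∫ z, ψ z ∂μ = 1 := b.integral_normed
  have hψ0 : ∀ z, 0 ≤ ψ z := b.nonneg_normed
  have hint : ∀ h : E → ℝ, Continuous h → Integrable (fun z => ψ z * h z) μ := fun h hh =>
    (b.continuous_normed.mul hh).integrable_of_hasCompactSupport
      b.hasCompactSupport_normed.mul_right
  let Φ : E → ℝ := fun x => ∫ z, ψ z * F (x - r x • z) ∂μ
  have hΦA : EqOn Φ F A := by
    intro p hp
    simp only [Φ, hrz p hp, zero_smul, sub_zero]
    rw [integral_mul_const, hψ1, one_mul]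
  have hΦL : ∀ p ∈ A, ∀ η > 0, ∃ δ > 0, ∀ x ∈ ball p δ, ∀ x' ∈ ball p δ,
      |Φ x - Φ x' - L p (x - x')| ≤ η * ‖x - x'‖ := by
    intro p hp η hη
    have hrd : HasStrictFDerivAt r (0 : E →L[ℝ] ℝ) p := by
      have := hr.hasStrictFDerivAt (x := p) one_ne_zero
      rwa [IsLocalMin.fderiv_eq_zero (Eventually.of_forall fun x => by
        rw [hrz p hp]; exact hr0 x)] at this
    obtain ⟨δ₁, hδ₁, h₁⟩ := hFL p hp (η / 4) (by positivity)
    obtain ⟨ε, hε, hε1, hεL⟩ : ∃ ε > 0, ε ≤ 1 ∧ ‖L p‖ * ε ≤ η / 2 := by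
      refine ⟨min 1 (η / 2 / (‖L p‖ + 1)), by positivity, min_le_left _ _, ?_⟩
      calc ‖L p‖ * min 1 (η / 2 / (‖L p‖ + 1))
          ≤ (‖L p‖ + 1) * (η / 2 / (‖L p‖ + 1)) := by
            gcongr
            · linarith
            · exact min_le_right _ _
        _ = _ := by field_simp
    obtain ⟨δ₂, hδ₂, h₂⟩ : ∃ δ > 0, ∀ x ∈ ball p δ, ∀ x' ∈ ball p δ,
        |r x - r x'| ≤ ε * ‖x - x'‖ := by
      have := hrd.isLittleO.def hε
      obtain ⟨δ, hδ, h⟩ := Metric.eventually_nhds_iff_ball.1 this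
      refine ⟨δ, hδ, fun x hx x' hx' => ?_⟩
      have := h (x, x') (by rw [← ball_prod_same]; exact ⟨hx, hx'⟩)
      simpa using this
    refine ⟨min (δ₁ / 2) δ₂, by positivity, fun x hx x' hx' => ?_⟩
    have hin : ∀ x ∈ ball p (min (δ₁ / 2) δ₂), ∀ z ∈ closedBall (0 : E) 1,
        x - r x • z ∈ ball p δ₁ := by
      intro x hx z hz
      rw [mem_ball, dist_eq_norm, lt_min_iff] at hx
      rw [mem_closedBall_zero_iff] at hz
      have h3 := h₂ x (by rw [mem_ball, dist_eq_norm]; exact hx.2) p (mem_ball_self hδ₂)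
      rw [hrz p hp, sub_zero] at h3
      rw [mem_ball, dist_eq_norm, sub_right_comm]
      have h4 := norm_sub_le (x - p) (r x • z)
      rw [norm_smul, Real.norm_eq_abs] at h4
      nlinarith [norm_nonneg (x - p), norm_nonneg z, abs_nonneg (r x)]
    have hpt : ∀ z ∈ closedBall (0 : E) 1,
        |F (x - r x • z) - F (x' - r x' • z) - L p (x - x')| ≤ η * ‖x - x'‖ := by
      intro z hz
      have h3 := h₁ _ (hin x hx z hz) _ (hin x' hx' z hz)
      have h4 := h₂ x (ball_subset_ball (min_le_right _ _) hx) x'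
        (ball_subset_ball (min_le_right _ _) hx')
      have h5 : x - r x • z - (x' - r x' • z) = (x - x') - (r x - r x') • z := by
        rw [sub_smul]; abel
      rw [mem_closedBall_zero_iff] at hz
      have h6 : ‖(r x - r x') • z‖ ≤ ε * ‖x - x'‖ := by
        rw [norm_smul, Real.norm_eq_abs]
        nlinarith [norm_nonneg z, abs_nonneg (r x - r x')]
      have h7 : |L p ((r x - r x') • z)| ≤ η / 2 * ‖x - x'‖ := by
        refine ((L p).le_opNorm _).trans ?_
        nlinarith [norm_nonneg (L p), norm_nonneg (x - x'),
          mul_le_mul_of_nonneg_left h6 (norm_nonneg (L p))]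
      have h8 := norm_sub_le (x - x') ((r x - r x') • z)
      rw [h5, map_sub] at h3
      have h9 : η / 4 * ‖x - x' - (r x - r x') • z‖ ≤ η / 2 * ‖x - x'‖ := by
        have : ‖x - x' - (r x - r x') • z‖ ≤ 2 * ‖x - x'‖ := by
          nlinarith [norm_nonneg (x - x')]
        nlinarith
      rw [abs_le] at h3 h7 ⊢
      constructor <;> linarith
    have hcont : ∀ y, Continuous fun z => F (y - r y • z) := fun y => by fun_prop
    have e1 : Φ x - Φ x' - L p (x - x')
        = ∫ z, ψ z * (F (x - r x • z) - F (x' - r x' • z) - L p (x - x')) ∂μ := by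
      simp only [mul_sub]
      rw [integral_sub, integral_sub (hint _ (hcont x)) (hint _ (hcont x')), integral_mul_const,
        hψ1, one_mul]
      · exact (hint _ (hcont x)).sub (hint _ (hcont x'))
      · exact hint _ continuous_const
    rw [e1, ← Real.norm_eq_abs]
    refine (norm_integral_le_of_norm_le (hint _ (continuous_const (y := η * ‖x - x'‖)))
      (Eventually.of_forall fun z => ?_)).trans_eq ?_
    · rw [norm_mul, Real.norm_of_nonneg (hψ0 z)]
      by_cases hz : z ∈ closedBall (0 : E) 1
      · exact mul_le_mul_of_nonneg_left (hpt z hz) (hψ0 z)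
      · simp [hψs z hz]
    · rw [integral_mul_const, hψ1, one_mul]
  have hΦd : ∀ p ∈ A, HasFDerivAt Φ (L p) p := by
    intro p hp
    rw [hasFDerivAt_iff_isLittleO, Asymptotics.isLittleO_iff]
    intro η hη
    obtain ⟨δ, hδ, h⟩ := hΦL p hp η hη
    filter_upwards [ball_mem_nhds p hδ] with x hx using h x hx p (mem_ball_self hδ)
  have hΦC : ∀ x, x ∉ A → ContDiffAt ℝ 1 Φ x := fun x hx =>
    contDiffAt_integral_mul_comp_sub_smul μ hF b.contDiff_normed hψs hr (hrpos x hx)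
  have hΦD : Differentiable ℝ Φ := fun x => by
    by_cases hx : x ∈ A
    · exact (hΦd x hx).differentiableAt
    · exact (hΦC x hx).differentiableAt one_ne_zero
  refine ⟨Φ, contDiff_one_iff_fderiv.2 ⟨hΦD, continuous_iff_continuousAt.2 fun x => ?_⟩, hΦA, hΦd⟩
  by_cases hx : x ∈ A
  · rw [Metric.continuousAt_iff]
    intro η hη
    obtain ⟨δ, hδ, h⟩ := hΦL x hx (η / 2) (by positivity)
    refine ⟨δ, hδ, fun {y} hy => ?_⟩
    rw [(hΦd x hx).fderiv, dist_eq_norm,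
      ← ((hΦD y).hasFDerivAt.sub (L x).hasFDerivAt).fderiv]
    refine (norm_fderiv_le_of_lip' ℝ (half_pos hη).le ?_).trans_lt (half_lt_self hη)
    filter_upwards [isOpen_ball.mem_nhds hy] with z hz
    have := h z hz y hy
    rw [map_sub] at this
    rw [Real.norm_eq_abs, Pi.sub_apply, Pi.sub_apply]
    convert this using 2
    ring
  · exact (hΦC x hx).continuousAt_fderiv one_ne_zero

/-- **Whitney's extension theorem**, `C¹` case, for scalar functions on compact sets. -/
theorem exists_contDiff_one_extension [FiniteDimensional ℝ E] {A : Set E} (hA : IsCompact A)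
    {f : E → ℝ} {L : E → E →L[ℝ] ℝ} (hf : ContinuousOn f A) (hL : ContinuousOn L A)
    (hw : ∀ η > 0, ∃ δ > 0, ∀ x ∈ A, ∀ y ∈ A, ‖x - y‖ < δ →
      |f x - f y - L y (x - y)| ≤ η * ‖x - y‖) :
    ∃ Φ : E → ℝ, ContDiff ℝ 1 Φ ∧ EqOn Φ f A ∧ ∀ p ∈ A, HasFDerivAt Φ (L p) p := by
  rcases A.eq_empty_or_nonempty with rfl | hne
  · exact ⟨fun _ => 0, contDiff_const, by simp, by simp⟩
  obtain ⟨F, hF, hFf, hFL⟩ := exists_continuous_extension_nearly_linear hA hne hf hL hw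
  obtain ⟨Φ, hΦ, hΦF, hΦd⟩ := exists_contDiff_eqOn_of_nearly_linear hA.isClosed hF hFL
  exact ⟨Φ, hΦ, hΦF.trans hFf, hΦd⟩

/-- **Whitney's extension theorem**, `C¹` case, for vector-valued functions on compact sets. -/
theorem exists_contDiff_one_extension_euclidean [FiniteDimensional ℝ E] {ι : Type*} [Fintype ι]
    {A : Set E} (hA : IsCompact A) {f : E → EuclideanSpace ℝ ι}
    {L : E → E →L[ℝ] EuclideanSpace ℝ ι} (hf : ContinuousOn f A) (hL : ContinuousOn L A)
    (hw : ∀ η > 0, ∃ δ > 0, ∀ x ∈ A, ∀ y ∈ A, ‖x - y‖ < δ →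
      ‖f x - f y - L y (x - y)‖ ≤ η * ‖x - y‖) :
    ∃ Φ : E → EuclideanSpace ℝ ι, ContDiff ℝ 1 Φ ∧ EqOn Φ f A ∧
      ∀ p ∈ A, HasFDerivAt Φ (L p) p := by
  have hcoord : ∀ i, ∃ Φ : E → ℝ, ContDiff ℝ 1 Φ ∧ EqOn Φ (fun x => f x i) A ∧
      ∀ p ∈ A, HasFDerivAt Φ ((EuclideanSpace.proj i : EuclideanSpace ℝ ι →L[ℝ] ℝ) ∘L L p) p := by
    intro i
    refine exists_contDiff_one_extension hA
      ((EuclideanSpace.proj i : EuclideanSpace ℝ ι →L[ℝ] ℝ).continuous.comp_continuousOn hf)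
      (continuousOn_const.clm_comp hL) fun η hη => ?_
    obtain ⟨δ, hδ, h⟩ := hw η hη
    exact ⟨δ, hδ, fun x hx y hy hxy =>
      (PiLp.norm_apply_le (f x - f y - L y (x - y)) i).trans (h x hx y hy hxy)⟩
  choose Φ hΦ hΦf hΦd using hcoord
  refine ⟨fun x => WithLp.toLp 2 fun i => Φ i x, contDiff_euclidean.2 hΦ, fun p hp => ?_,
    fun p hp => ?_⟩
  · ext i
    exact hΦf i hp
  · rw [← hasFDerivWithinAt_univ, hasFDerivWithinAt_euclidean]
    exact fun i => (hΦd i p hp).hasFDerivWithinAt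


/-- If every tangent direction of a compact set `K`, injectively projected to the first factor, lies
in the graph of `D p`, then `K` satisfies Whitney's condition uniformly. -/
theorem whitney_condition_of_tangentDirections {E F : Type*} [NormedAddCommGroup E]
    [NormedSpace ℝ E] [FiniteDimensional ℝ E] [NormedAddCommGroup F] [NormedSpace ℝ F]
    [FiniteDimensional ℝ F] {K : Set (E × F)} (hK : IsCompact K)
    (hvert : ∀ p ∈ K, ∀ q ∈ K, p.1 = q.1 → p = q) {D : E × F → E →L[ℝ] F}
    (hD : ContinuousOn D K) (htan : ∀ p ∈ K, ∀ w ∈ tangentDirections K p, w.2 = D p w.1)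
    {η : ℝ} (hη : 0 < η) :
    ∃ δ > 0, ∀ p ∈ K, ∀ q ∈ K, ‖p.1 - q.1‖ < δ →
      ‖p.2 - q.2 - D q (p.1 - q.1)‖ ≤ η * ‖p.1 - q.1‖ := by
  by_contra! hcon
  choose p hp q hq hpq hlt using fun n : ℕ => hcon (1 / ((n : ℝ) + 1)) Nat.one_div_pos_of_nat
  have hne : ∀ n, p n ≠ q n := fun n h => by simpa [h] using hlt n
  have hpos : ∀ n, 0 < ‖p n - q n‖ := fun n => norm_pos_iff.2 (sub_ne_zero.2 (hne n))
  let w : ℕ → E × F := fun n => ‖p n - q n‖⁻¹ • (p n - q n)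
  have hw : ∀ n, w n ∈ sphere (0 : E × F) 1 := fun n => by
    rw [mem_sphere_zero_iff_norm, norm_smul, norm_inv, norm_norm, inv_mul_cancel₀ (hpos n).ne']
  obtain ⟨⟨p₀, q₀, w₀⟩, ⟨hp₀, hq₀, hw₀⟩, θ, hθ, hlim⟩ :=
    (hK.prod (hK.prod (isCompact_sphere (0 : E × F) 1))).tendsto_subseq
      (x := fun n => (p n, q n, w n)) fun n => ⟨hp n, hq n, hw n⟩
  have hpl : Tendsto (fun n => p (θ n)) atTop (𝓝 p₀) := (continuous_fst.tendsto _).comp hlim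
  have hql : Tendsto (fun n => q (θ n)) atTop (𝓝 q₀) :=
    ((continuous_fst.comp continuous_snd).tendsto _).comp hlim
  have hwl : Tendsto (fun n => w (θ n)) atTop (𝓝 w₀) :=
    ((continuous_snd.comp continuous_snd).tendsto _).comp hlim
  obtain rfl : p₀ = q₀ := by
    refine hvert _ hp₀ _ hq₀ (sub_eq_zero.1 (tendsto_nhds_unique
      ((continuous_fst.tendsto _).comp (hpl.sub hql)) ?_))
    refine squeeze_zero_norm (fun n => (hpq (θ n)).le) ?_
    exact tendsto_one_div_add_atTop_nhds_zero_nat.comp hθ.tendsto_atTop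
  have hdir : w₀ ∈ tangentDirections K p₀ := by
    intro ε hε
    refine mem_closure_of_tendsto hwl ?_
    filter_upwards [hpl (ball_mem_nhds p₀ hε), hql (ball_mem_nhds p₀ hε)] with n h1 h2
    exact ⟨_, ⟨hp _, h1⟩, _, ⟨hq _, h2⟩, hne _, rfl⟩
  have hDl : Tendsto (fun n => D (q (θ n))) atTop (𝓝 (D p₀)) :=
    (hD p₀ hp₀).tendsto.comp (tendsto_nhdsWithin_iff.2 ⟨hql, Eventually.of_forall fun n => hq _⟩)
  have hw1 : Tendsto (fun n => (w (θ n)).1) atTop (𝓝 w₀.1) := (continuous_fst.tendsto _).comp hwl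
  have hw2 : Tendsto (fun n => (w (θ n)).2) atTop (𝓝 w₀.2) := (continuous_snd.tendsto _).comp hwl
  have hle : η * ‖w₀.1‖ ≤ ‖w₀.2 - D p₀ w₀.1‖ := by
    refine le_of_tendsto_of_tendsto' (hw1.norm.const_mul η)
      (hw2.sub ((isBoundedBilinearMap_apply.continuous.tendsto (D p₀, w₀.1)).comp
        (hDl.prodMk_nhds hw1))).norm fun n => ?_
    have := mul_le_mul_of_nonneg_left (hlt (θ n)).le (inv_nonneg.2 (hpos (θ n)).le)
    simp only [w, Function.comp_apply, Prod.smul_fst, Prod.smul_snd, Prod.fst_sub, Prod.snd_sub, map_smul]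
    rw [← smul_sub, norm_smul, norm_smul, norm_inv, norm_norm]
    linarith
  have hw0 := htan p₀ hp₀ w₀ hdir
  rw [sub_eq_zero.2 hw0, norm_zero] at hle
  have h1 : w₀.1 = 0 := norm_le_zero_iff.1 (by nlinarith)
  rw [h1, map_zero] at hw0
  have : w₀ = 0 := Prod.ext h1 hw0
  simp [this] at hw₀

/-- A compact set meeting every vertical fibre in at most one point is the graph of a continuous
section over its projection. -/
theorem exists_continuousOn_section {X Y : Type*} [TopologicalSpace X] [T2Space X]
    [TopologicalSpace Y] {K : Set (X × Y)} (hK : IsCompact K) (hne : K.Nonempty)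
    (hvert : ∀ p ∈ K, ∀ q ∈ K, p.1 = q.1 → p = q) :
    ∃ s : X → X × Y, ContinuousOn s (Prod.fst '' K) ∧ MapsTo s (Prod.fst '' K) K ∧
      (∀ p ∈ K, s p.1 = p) := by
  have : Nonempty (X × Y) := ⟨hne.some⟩
  have hinj : InjOn (Prod.fst : X × Y → X) K := fun p hp q hq h => hvert p hp q hq h
  let s : X → X × Y := Function.invFunOn Prod.fst K
  have hmaps : MapsTo s (Prod.fst '' K) K := fun x hx => Function.invFunOn_mem hx
  refine ⟨s, ?_, hmaps, fun p hp => hinj.leftInvOn_invFunOn hp⟩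
  have := isCompact_iff_compactSpace.1 hK
  have hemb := ((continuous_fst.comp continuous_subtype_val).isClosedEmbedding
    hinj.injective : IsClosedEmbedding fun p : K => (p : X × Y).1)
  rw [continuousOn_iff_continuous_domRestrict]
  refine continuous_subtype_val.comp (g := ((↑) : K → X × Y))
    (f := fun x : Prod.fst '' K => ⟨s x, hmaps x.2⟩) (hemb.isEmbedding.continuous_iff.2 ?_)
  exact continuous_subtype_val.congr fun x => (Function.invFunOn_eq x.2).symm

end Whitney

/-- Corollary `c.whitney` (from Whitney's extension theorem).  We write
`ℝⁿ = ℝ^d × ℝ^{n-d}`.  Each candidate tangent plane `E(p)`, being a `d`-plane transverse to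
the vertical factor `{0} × ℝ^{n-d}`, is encoded as the graph of a continuous linear map
`D p : ℝ^d → ℝ^{n-d}`, and continuity of `p ↦ E(p)` as continuity of `p ↦ D p`.
If every vertical fiber meets the compact set `K` in at most one point and
`T_pK ⊆ E(p)` for all `p ∈ K`, then `K` lies in the graph of a `C¹` map
`Φ : ℝ^d → ℝ^{n-d}` whose tangent spaces along `K` are exactly the planes `E(p)`,
i.e. `fderiv Φ = D` on `K`. -/
theorem stmt_1 (d c : ℕ)
    (K : Set (EuclideanSpace ℝ (Fin d) × EuclideanSpace ℝ (Fin c)))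
    (hK : IsCompact K)
    (hvert : ∀ p ∈ K, ∀ q ∈ K, p.1 = q.1 → p = q)
    (D : EuclideanSpace ℝ (Fin d) × EuclideanSpace ℝ (Fin c) →
      (EuclideanSpace ℝ (Fin d) →L[ℝ] EuclideanSpace ℝ (Fin c)))
    (hDcont : ContinuousOn D K)
    (htan : ∀ p ∈ K, ∀ w : EuclideanSpace ℝ (Fin d) × EuclideanSpace ℝ (Fin c),
      w ∈ tangentSet K p → w.2 = D p w.1) :
    ∃ Φ : EuclideanSpace ℝ (Fin d) → EuclideanSpace ℝ (Fin c),
      ContDiff ℝ 1 Φ ∧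
      (∀ p ∈ K, p.2 = Φ p.1) ∧
      (∀ p ∈ K, fderiv ℝ Φ p.1 = D p) := by
  rcases K.eq_empty_or_nonempty with rfl | hne
  · exact ⟨fun _ => 0, contDiff_const, by simp, by simp⟩
  obtain ⟨s, hs, hsK, hsp⟩ := exists_continuousOn_section hK hne hvert
  have hw : ∀ η > 0, ∃ δ > 0, ∀ x ∈ Prod.fst '' K, ∀ y ∈ Prod.fst '' K, ‖x - y‖ < δ →
      ‖(s x).2 - (s y).2 - D (s y) (x - y)‖ ≤ η * ‖x - y‖ := by
    intro η hη
    obtain ⟨δ, hδ, h⟩ := whitney_condition_of_tangentDirections hK hvert hDcont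
      (fun p hp w hw => htan p hp w (Submodule.subset_span hw)) hη
    refine ⟨δ, hδ, ?_⟩
    rintro _ ⟨p, hp, rfl⟩ _ ⟨q, hq, rfl⟩ hpq
    rw [hsp p hp, hsp q hq]
    exact h p hp q hq hpq
  obtain ⟨Φ, hΦ, hΦf, hΦd⟩ := exists_contDiff_one_extension_euclidean (hK.image continuous_fst)
    (f := fun x => (s x).2) (L := fun x => D (s x)) (continuous_snd.comp_continuousOn hs)
    (hDcont.comp hs hsK) hw
  refine ⟨Φ, hΦ, fun p hp => ?_, fun p hp => ?_⟩
  · simp only [hΦf (Set.mem_image_of_mem _ hp), hsp p hp]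
  · rw [(hΦd p.1 (Set.mem_image_of_mem _ hp)).fderiv, hsp p hp]
end

section
/- Let g be a C¹ diffeomorphism whose restriction to a locally invariant one-dimensional C¹ submanifold Γ (a finite disjoint union of compact curves and circles) contains a compact invariant set Λ. Then every minimal subset C of Λ is either a periodic orbit, a periodic circle (a finite union of circles permuted by g), or a Cantor set; and if all periodic orbits of g in Γ are hyperbolic and every minimal set is a Hausdorff limit of periodic orbits, then Λ contains no non-periodic minimal set and only finitely many periodic orbits. -/
open Set

section

variable {W : Type*} [NormedAddCommGroup W] [NormedSpace ℝ W]

/-- Local graph description of a `d`-dimensional `C¹` submanifold. -/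
def IsC1SubmanifoldAt (d : ℕ) (S : Set W) (z : W) : Prop :=
  ∃ (P Q : Submodule ℝ W) (ψ : P → Q) (U : Set W),
    Module.finrank ℝ P = d ∧ IsCompl P Q ∧
    ContDiff ℝ 1 (fun p : P => (ψ p : W)) ∧
    IsOpen U ∧ z ∈ U ∧
    S ∩ U = {x ∈ U | ∃ p : P, x = (p : W) + ((ψ p : W))}

/-- `C` is a minimal set for `g`. -/
def IsMinimalSet (g : W → W) (C : Set W) : Prop :=
  C.Nonempty ∧ IsCompact C ∧ g '' C = C ∧
    ∀ C' ⊆ C, C'.Nonempty → IsClosed C' → g '' C' = C' → C' = C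

/-- `C` is a (finite) periodic orbit of `g`. -/
def IsPeriodicOrbitSet (g : W → W) (C : Set W) : Prop :=
  ∃ (x : W) (n : ℕ), 0 < n ∧ g^[n] x = x ∧ C = {y | ∃ k : ℕ, y = g^[k] x}

/-- `C` is a periodic circle: a finite union of topological circles permuted by `g`. -/
def IsPeriodicCircleSet (g : W → W) (C : Set W) : Prop :=
  ∃ (k : ℕ) (circ : Fin k → Set W), 0 < k ∧
    (∀ i, Nonempty (↥(circ i) ≃ₜ ↥(Metric.sphere (0 : ℂ) 1))) ∧
    (⋃ i, circ i) = C ∧ ∀ i, ∃ j, g '' circ i = circ j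

/-- `C` is a Cantor set: compact, perfect and totally disconnected. -/
def IsCantorSet' (C : Set W) : Prop :=
  IsCompact C ∧ Perfect C ∧ IsTotallyDisconnected C

end

section LineChart

variable {X : Type*} [TopologicalSpace X]

/-- `β` parametrizes by the real line a relatively open piece of `S` around `z = β 0`. -/
def IsLineChartAt (S : Set X) (z : X) (β : ℝ → X) : Prop :=
  Topology.IsEmbedding β ∧ (∃ O, IsOpen O ∧ S ∩ O = range β) ∧ β 0 = z

namespace IsLineChartAt

variable {S : Set X} {z : X} {β : ℝ → X}

lemma continuous (h : IsLineChartAt S z β) : Continuous β := h.1.continuous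

lemma injective (h : IsLineChartAt S z β) : Function.Injective β := h.1.injective

lemma mem (h : IsLineChartAt S z β) (u : ℝ) : β u ∈ S := by
  obtain ⟨O, -, hO⟩ := h.2.1
  exact (hO.ge (mem_range_self u)).1

lemma exists_isOpen_image (h : IsLineChartAt S z β) {V : Set ℝ} (hV : IsOpen V) :
    ∃ O, IsOpen O ∧ S ∩ O = β '' V := by
  obtain ⟨O, hO, hSO⟩ := h.2.1
  obtain ⟨O', hO', rfl⟩ := h.1.isInducing.isOpen_iff.1 hV
  exact ⟨O ∩ O', hO.inter hO', by rw [image_preimage_eq_range_inter, ← hSO, inter_assoc]⟩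

lemma neg (h : IsLineChartAt S z β) : IsLineChartAt S z (fun u => β (-u)) := by
  refine ⟨h.1.comp (Homeomorph.neg ℝ).isEmbedding, ?_, by simpa using h.2.2⟩
  obtain ⟨O, hO, hSO⟩ := h.2.1
  refine ⟨O, hO, hSO.trans ?_⟩
  exact ((Homeomorph.neg ℝ).surjective.range_comp β).symm

lemma exists_Icc_subset (h : IsLineChartAt S z β) {U : Set X} (hU : U ∈ nhds z) :
    ∃ s > 0, β '' Icc (-s) s ⊆ U := by
  have : β ⁻¹' U ∈ nhds (0 : ℝ) := h.continuous.continuousAt (by rwa [h.2.2])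
  obtain ⟨s, hs, hsub⟩ := Metric.nhds_basis_closedBall.mem_iff.1 this
  refine ⟨s, hs, image_subset_iff.2 ?_⟩
  rwa [Real.closedBall_eq_Icc, zero_sub, zero_add] at hsub

/-- A connected set cannot leave a chart interval whose endpoints it avoids. -/
lemma subset_image_Ioo [T2Space X] (h : IsLineChartAt S z β) {T : Set X} (hT : IsPreconnected T)
    (hTS : T ⊆ S) {a b : ℝ} (ha : β a ∉ T) (hb : β b ∉ T)
    (hne : (T ∩ β '' Ioo a b).Nonempty) : T ⊆ β '' Ioo a b := by
  obtain ⟨O, hO, hSO⟩ := h.exists_isOpen_image (isOpen_Ioo (a := a) (b := b))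
  have hK : IsClosed (β '' Icc a b) := (isCompact_Icc.image h.continuous).isClosed
  have hcov : T ⊆ O ∪ (β '' Icc a b)ᶜ := by
    intro t ht
    by_cases htK : t ∈ β '' Icc a b
    · left
      obtain ⟨u, hu, rfl⟩ := htK
      have h1 : u ≠ a := by rintro rfl; exact ha ht
      have h2 : u ≠ b := by rintro rfl; exact hb ht
      exact (hSO.ge ⟨u, ⟨lt_of_le_of_ne hu.1 h1.symm, lt_of_le_of_ne hu.2 h2⟩, rfl⟩).2
    · exact Or.inr htK
  have hTO : (T ∩ O).Nonempty := by
    obtain ⟨t, ht, ht'⟩ := hne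
    exact ⟨t, ht, (hSO.ge ht').2⟩
  have hsub : T ∩ O ⊆ β '' Ioo a b := fun t ht => hSO.le ⟨hTS ht.1, ht.2⟩
  have hdis : ¬ (T ∩ (O ∩ (β '' Icc a b)ᶜ)).Nonempty := by
    rintro ⟨t, ht, htO, htK⟩
    exact htK (image_mono Ioo_subset_Icc_self (hsub ⟨ht, htO⟩))
  intro t ht
  rcases hcov ht with htO | htK
  · exact hsub ⟨ht, htO⟩
  · exact (hdis (hT _ _ hO hK.isOpen_compl hcov hTO ⟨t, ht, htK⟩)).elim

/-- A nondegenerate connected subset of a curve contains an arc of the curve. -/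
lemma exists_image_Ioo_subset [T2Space X] (h : IsLineChartAt S z β) {T : Set X}
    (hT : IsPreconnected T) (hTS : T ⊆ S) (hz : z ∈ T) {y : X} (hy : y ∈ T) (hyz : y ≠ z) :
    ∃ a b : ℝ, a < b ∧ β '' Ioo a b ⊆ T := by
  obtain ⟨s, hs, hsub⟩ := h.exists_Icc_subset (isOpen_compl_singleton.mem_nhds hyz.symm)
  by_contra! hcon
  obtain ⟨_, ⟨a, ha, rfl⟩, ha'⟩ := not_subset.1 (hcon (-s) 0 (by linarith))
  obtain ⟨_, ⟨b, hb, rfl⟩, hb'⟩ := not_subset.1 (hcon 0 s hs)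
  have := h.subset_image_Ioo hT hTS ha' hb' ⟨z, hz, 0, ⟨ha.2, hb.1⟩, h.2.2⟩ hy
  obtain ⟨u, hu, rfl⟩ := this
  exact hsub ⟨u, ⟨by linarith [ha.1, hu.1], by linarith [hb.2, hu.2]⟩, rfl⟩ rfl

end IsLineChartAt

/-- Only finitely many points of `C` are endpoints of connected subsets of `S \ C` that leave a
given neighbourhood of `C`. -/
lemma finite_endpoints [T2Space X] {S C W : Set X} (hC : IsCompact C) (hCS : C ⊆ S)
    (hch : ∀ c ∈ C, ∃ β, IsLineChartAt S c β) (hW : IsOpen W) (hCW : C ⊆ W) :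
    {e ∈ C | ∃ T, IsPreconnected T ∧ T ⊆ S \ C ∧ ¬ T ⊆ W ∧ e ∈ closure T}.Finite := by
  set E := {e ∈ C | ∃ T, IsPreconnected T ∧ T ⊆ S \ C ∧ ¬ T ⊆ W ∧ e ∈ closure T} with hE
  suffices (E ∩ C).Finite by
    exact this.subset fun e he => ⟨he, he.1⟩
  refine hC.induction_on (p := fun s => (E ∩ s).Finite) (by simp)
    (fun s t hst ht => ht.subset (inter_subset_inter_right _ hst))
    (fun s t hs ht => by rw [inter_union_distrib_left]; exact hs.union ht) ?_
  intro c hc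
  obtain ⟨β, hβ⟩ := hch c hc
  obtain ⟨s, hs, hsub⟩ := hβ.exists_Icc_subset (hW.mem_nhds (hCW hc))
  obtain ⟨O, hO, hSO⟩ := hβ.exists_isOpen_image (isOpen_Ioo (a := -s) (b := s))
  have hcO : c ∈ O := (hSO.ge ⟨0, ⟨by linarith, hs⟩, hβ.2.2⟩).2
  refine ⟨C ∩ O, inter_mem_nhdsWithin _ (hO.mem_nhds hcO), ?_⟩
  have hA : IsCompact (β ⁻¹' C ∩ Icc (-s) s) :=
    isCompact_Icc.inter_left (hC.isClosed.preimage hβ.continuous)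
  have hAne : (β ⁻¹' C ∩ Icc (-s) s).Nonempty :=
    ⟨0, by simpa [hβ.2.2] using hc, by constructor <;> linarith⟩
  obtain ⟨a, ⟨haC, has⟩, ha⟩ := hA.exists_isLeast hAne
  obtain ⟨b, ⟨hbC, hbs⟩, hb⟩ := hA.exists_isGreatest hAne
  refine (Set.toFinite {β a, β b}).subset ?_
  rintro e ⟨⟨heC, T, hT, hTS, hTW, heT⟩, -, heO⟩
  obtain ⟨u, hu, rfl⟩ := hSO.le ⟨hCS heC, heO⟩
  have hua : a ≤ u := ha ⟨heC, Ioo_subset_Icc_self hu⟩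
  have hub : u ≤ b := hb ⟨heC, Ioo_subset_Icc_self hu⟩
  by_contra hne
  simp only [mem_insert_iff, mem_singleton_iff, not_or, hβ.injective.eq_iff] at hne
  have huab : u ∈ Ioo a b := ⟨lt_of_le_of_ne hua (Ne.symm hne.1), lt_of_le_of_ne hub hne.2⟩
  obtain ⟨O', hO', hSO'⟩ := hβ.exists_isOpen_image (isOpen_Ioo (a := a) (b := b))
  obtain ⟨t, htO, htT⟩ := mem_closure_iff.1 heT O' hO' (hSO'.ge ⟨u, huab, rfl⟩).2
  have := hβ.subset_image_Ioo hT (hTS.trans sdiff_subset) (fun h => (hTS h).2 haC)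
    (fun h => (hTS h).2 hbC) ⟨t, htT, hSO'.le ⟨(hTS htT).1, htO⟩⟩
  refine hTW (this.trans (Subset.trans (image_mono ?_) hsub))
  exact Ioo_subset_Icc_self.trans (Icc_subset_Icc has.1 hbs.2)

/-- Points of `S \ C` close to `C` are joined inside `S \ C` to a point of `C` by a short arc. -/
lemma exists_short_arc {X : Type*} [MetricSpace X] {S C : Set X} (hC : IsCompact C)
    (hch : ∀ c ∈ C, ∃ β, IsLineChartAt S c β) {η : ℝ} (hη : 0 < η) :
    ∃ ε > 0, ∀ x ∈ S \ C, x ∈ Metric.thickening ε C → ∃ e ∈ C, ∃ T, IsPreconnected T ∧ x ∈ T ∧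
      T ⊆ S \ C ∧ T ⊆ Metric.ball e η ∧ e ∈ closure T := by
  have key : ∀ c ∈ C, ∀ β, IsLineChartAt S c β → ∀ s > 0,
      β '' Icc (-s) s ⊆ Metric.ball c (η / 2) → ∀ u ∈ Ioo 0 s, β u ∉ C →
      ∃ e ∈ C, ∃ T, IsPreconnected T ∧ β u ∈ T ∧
      T ⊆ S \ C ∧ T ⊆ Metric.ball e η ∧ e ∈ closure T := by
    intro c hc β hβ s hs hsub u hu huC
    have hA : IsCompact (β ⁻¹' C ∩ Icc 0 u) :=
      isCompact_Icc.inter_left (hC.isClosed.preimage hβ.continuous)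
    obtain ⟨a, ⟨haC, ha0⟩, ha⟩ := hA.exists_isGreatest
      ⟨0, by simpa [hβ.2.2] using hc, le_refl _, hu.1.le⟩
    have hau : a < u := lt_of_le_of_ne ha0.2 (by rintro rfl; exact huC haC)
    have hball : ∀ v ∈ Icc 0 u, dist (β v) c < η / 2 := fun v hv =>
      hsub ⟨v, ⟨by linarith [hv.1], by linarith [hv.2, hu.2]⟩, rfl⟩
    refine ⟨β a, haC, β '' Ioc a u, isPreconnected_Ioc.image _ hβ.continuous.continuousOn,
      ⟨u, ⟨hau, le_rfl⟩, rfl⟩, ?_, ?_, ?_⟩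
    · rintro _ ⟨v, hv, rfl⟩
      exact ⟨hβ.mem v, fun hvC => (ha ⟨hvC, ha0.1.trans hv.1.le, hv.2⟩).not_gt hv.1⟩
    · rintro _ ⟨v, hv, rfl⟩
      have h1 := hball v ⟨ha0.1.trans hv.1.le, hv.2⟩
      have h2 := hball a ha0
      rw [dist_comm] at h2
      exact (dist_triangle _ c _).trans_lt (by linarith)
    · refine image_closure_subset_closure_image hβ.continuous ⟨a, ?_, rfl⟩
      rw [closure_Ioc hau.ne]
      exact ⟨le_rfl, hau.le⟩
  have hex : ∀ c ∈ C, ∃ O, IsOpen O ∧ c ∈ O ∧ ∀ x ∈ S \ C, x ∈ O →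
      ∃ e ∈ C, ∃ T, IsPreconnected T ∧ x ∈ T ∧
      T ⊆ S \ C ∧ T ⊆ Metric.ball e η ∧ e ∈ closure T := by
    intro c hc
    obtain ⟨β, hβ⟩ := hch c hc
    obtain ⟨s, hs, hsub⟩ := hβ.exists_Icc_subset (Metric.ball_mem_nhds c (half_pos hη))
    obtain ⟨O, hO, hSO⟩ := hβ.exists_isOpen_image (isOpen_Ioo (a := -s) (b := s))
    refine ⟨O, hO, (hSO.ge ⟨0, ⟨by linarith, hs⟩, hβ.2.2⟩).2, ?_⟩
    rintro x ⟨hxS, hxC⟩ hxO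
    obtain ⟨u, hu, rfl⟩ := hSO.le ⟨hxS, hxO⟩
    rcases lt_trichotomy u 0 with h | h | h
    · have := key c hc _ hβ.neg s hs
        (by
          rintro _ ⟨v, hv, rfl⟩
          exact hsub ⟨-v, ⟨by linarith [hv.2], by linarith [hv.1]⟩, rfl⟩)
        (-u) ⟨by linarith, by linarith [hu.1]⟩
      simp only [neg_neg] at this
      exact this hxC
    · subst h
      exact (hxC (by rwa [hβ.2.2])).elim
    · exact key c hc β hβ s hs hsub u ⟨h, hu.2⟩ hxC
  choose! O hO hcO hprop using hex
  obtain ⟨ε, hε, hsub⟩ := hC.exists_thickening_subset_open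
    (isOpen_biUnion fun c hc => hO c hc) (fun c hc => mem_biUnion hc (hcO c hc))
  refine ⟨ε, hε, fun x hx hxε => ?_⟩
  obtain ⟨c, hc, hxc⟩ := mem_iUnion₂.1 (hsub hxε)
  exact hprop c hc x hx hxc

/-- A compact invariant set without periodic points in a locally invariant curve is isolated from
periodic orbits of the curve. -/
lemma exists_thickening_no_periodic {X : Type*} [MetricSpace X] {S C W : Set X} {f : X → X}
    (hf : Continuous f) (hinj : Function.Injective f)
    (hC : IsCompact C) (hCS : C ⊆ S) (hch : ∀ c ∈ C, ∃ β, IsLineChartAt S c β)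
    (hfC : ∀ x, f x ∈ C ↔ x ∈ C) (hnp : ∀ x ∈ C, ∀ n, 0 < n → f^[n] x ≠ x)
    (hW : IsOpen W) (hCW : C ⊆ W) (hfS : ∀ x ∈ S ∩ W, f x ∈ S) :
    ∃ ε > 0, ∀ x n, 0 < n → f^[n] x = x → ¬ ∀ k, f^[k] x ∈ S ∩ Metric.thickening ε C := by
  have hfCk : ∀ k x, f^[k] x ∈ C ↔ x ∈ C := by
    intro k
    induction k with
    | zero => simp
    | succ k ih => intro x; rw [Function.iterate_succ_apply, ih, hfC]
  have horb : ∀ e ∈ C, Function.Injective fun k => f^[k] e := by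
    intro e he
    suffices ∀ i j, i < j → f^[i] e ≠ f^[j] e by
      intro i j hij
      by_contra hne
      rcases lt_or_gt_of_ne hne with h | h
      exacts [this i j h hij, this j i h hij.symm]
    intro i j hij h
    obtain ⟨d, rfl⟩ := Nat.exists_eq_add_of_lt hij
    have : f^[i] (f^[d + 1] e) = f^[i] e := by
      rw [← Function.iterate_add_apply, h]; congr 1
    exact hnp e he (d + 1) d.succ_pos (hinj.iterate i this)
  set E := {e ∈ C | ∃ T, IsPreconnected T ∧ T ⊆ S \ C ∧ ¬ T ⊆ W ∧ e ∈ closure T} with hE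
  have hEfin : E.Finite := finite_endpoints hC hCS hch hW hCW
  -- a uniform time after which the orbits of points of `E` have left `E`
  obtain ⟨k₀, hk₀⟩ : ∃ k₀, ∀ e ∈ E, ∀ k, f^[k] e ∈ E → k < k₀ := by
    have hfin : (⋃ e ∈ E, (fun k => f^[k] e) ⁻¹' E).Finite :=
      hEfin.biUnion fun e he => hEfin.preimage (horb e he.1).injOn
    obtain ⟨m, hm⟩ := hfin.bddAbove
    exact ⟨m + 1, fun e he k hk => Nat.lt_succ_of_le (hm (mem_biUnion he hk))⟩
  obtain ⟨η, hη, hηW⟩ : ∃ η > 0, ∀ e ∈ E, ∀ k < k₀, ∀ y ∈ Metric.ball e η, f^[k] y ∈ W := by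
    have : ∀ᶠ η in nhdsWithin (0 : ℝ) (Ioi 0), ∀ e ∈ E, ∀ k ∈ Finset.range k₀,
        ∀ y ∈ Metric.ball e η, f^[k] y ∈ W := by
      rw [Filter.eventually_all_finite hEfin]
      intro e he
      rw [Filter.eventually_all_finset]
      intro k _
      have : (f^[k]) ⁻¹' W ∈ nhds e :=
        (hf.iterate k).continuousAt (hW.mem_nhds (hCW ((hfCk k e).2 he.1)))
      obtain ⟨r, hr, hsub⟩ := Metric.mem_nhds_iff.1 this
      filter_upwards [Ioo_mem_nhdsGT hr] with η hη y hy
      exact hsub (Metric.ball_subset_ball hη.2.le hy)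
    obtain ⟨η, h1, h2⟩ := (this.and self_mem_nhdsWithin).exists
    exact ⟨η, h2, fun e he k hk => h1 e he k (Finset.mem_range.2 hk)⟩
  obtain ⟨ε, hε, harc⟩ := exists_short_arc hC hch hη
  refine ⟨ε, hε, fun x n hn hx hall => ?_⟩
  by_cases hxC : x ∈ C
  · exact hnp x hxC n hn hx
  have hxk : ∀ k, f^[k] x ∉ C := fun k => (hfCk k x).not.2 hxC
  let J : X → X → Prop := fun y e => ∃ T, IsPreconnected T ∧ y ∈ T ∧ T ⊆ S \ C ∧ e ∈ closure T
  let Sh : X → Prop := fun y => ∀ T, IsPreconnected T → y ∈ T → T ⊆ S \ C → T ⊆ W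
  have push : ∀ T, IsPreconnected T → T ⊆ S \ C → T ⊆ W → ∀ y ∈ T, ∀ e, e ∈ closure T →
      IsPreconnected (f '' T) ∧ f y ∈ f '' T ∧ f '' T ⊆ S \ C ∧ f e ∈ closure (f '' T) := by
    intro T hT hTS hTW y hy e he
    refine ⟨hT.image _ hf.continuousOn, mem_image_of_mem _ hy, ?_,
      image_closure_subset_closure_image hf (mem_image_of_mem _ he)⟩
    rintro _ ⟨t, ht, rfl⟩
    exact ⟨hfS t ⟨(hTS ht).1, hTW ht⟩, (hfC t).not.2 (hTS ht).2⟩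
  have hstep : ∀ y e, Sh y → J y e → J (f y) (f e) := by
    rintro y e hy ⟨T, hT, hyT, hTS, heT⟩
    exact ⟨_, push T hT hTS (hy T hT hyT hTS) y hyT e heT⟩
  -- it suffices to follow an endpoint forever along the periodic orbit
  have hend : ∀ j, ∀ e ∈ C, (∀ k, J (f^[k] (f^[j] x)) (f^[k] e)) → False := by
    intro j e he hJ
    have hfin := finite_endpoints hC hCS hch (W := {f^[j] x}ᶜ) isOpen_compl_singleton
      (fun c hc => by rintro rfl; exact hxk j hc)
    refine ((Set.infinite_range_of_injective (fun a b hab =>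
      Nat.eq_of_mul_eq_mul_right hn (horb e he hab) :
        Function.Injective fun m : ℕ => f^[m * n] e)).mono ?_) hfin
    rintro _ ⟨m, rfl⟩
    refine ⟨(hfCk _ e).2 he, ?_⟩
    obtain ⟨T, hT, hyT, hTS, heT⟩ := hJ (m * n)
    refine ⟨T, hT, hTS, fun hsub => hsub hyT ?_, heT⟩
    rw [mem_singleton_iff, ← Function.iterate_add_apply, add_comm, Function.iterate_add_apply]
    have : Function.IsPeriodicPt f (m * n) x := Function.IsPeriodicPt.const_mul hx m
    rw [this.eq]
  by_cases hlong : ∀ k, Sh (f^[k] x)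
  · obtain ⟨e, he, T, hT, hxT, hTS, -, heT⟩ := harc x ⟨(hall 0).1, hxC⟩ (hall 0).2
    refine hend 0 e he fun k => ?_
    induction k with
    | zero => exact ⟨T, hT, hxT, hTS, heT⟩
    | succ k ih =>
      rw [Function.iterate_succ_apply', Function.iterate_succ_apply']
      exact hstep _ _ (hlong k) ih
  · push Not at hlong
    obtain ⟨j, hj⟩ := hlong
    simp only [Sh] at hj
    push Not at hj
    obtain ⟨L, hL, hjL, hLS, hLW⟩ := hj
    set y := f^[j] x with hy
    obtain ⟨e, he, T, hT, hyT, hTS, hTη, heT⟩ := harc y ⟨(hall j).1, hxk j⟩ (hall j).2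
    have heE : e ∈ E := ⟨he, T ∪ L, hT.union y hyT hjL hL, union_subset hTS hLS,
      fun h => hLW (subset_union_right.trans h), closure_mono subset_union_left heT⟩
    have hsmall : ∀ k, k ≤ k₀ → IsPreconnected (f^[k] '' T) ∧ f^[k] y ∈ f^[k] '' T ∧
        f^[k] '' T ⊆ S \ C ∧ f^[k] e ∈ closure (f^[k] '' T) := by
      intro k
      induction k with
      | zero => intro _; simpa using ⟨hT, hyT, hTS, heT⟩
      | succ k ih =>
        intro hk
        obtain ⟨h1, h2, h3, h4⟩ := ih (by omega)
        rw [Function.iterate_succ', image_comp]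
        refine push _ h1 h3 ?_ _ h2 _ h4
        rintro _ ⟨t, ht, rfl⟩
        exact hηW e heE k (by omega) t (hTη ht)
    refine hend j e he fun k => ?_
    induction k with
    | zero => exact ⟨T, hT, hyT, hTS, heT⟩
    | succ k ih =>
      rcases Nat.lt_or_ge k k₀ with hk | hk
      · exact ⟨_, hsmall (k + 1) hk⟩
      · rw [Function.iterate_succ_apply', Function.iterate_succ_apply']
        refine hstep _ _ (fun T' hT' hyT' hTS' => ?_) ih
        obtain ⟨T₁, hT₁, hyT₁, hTS₁, heT₁⟩ := ih
        by_contra hTW'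
        exact (hk₀ e heE k ⟨(hfCk k e).2 he, T₁ ∪ T', hT₁.union _ hyT₁ hyT' hT',
          union_subset hTS₁ hTS', fun h => hTW' (subset_union_right.trans h),
          closure_mono subset_union_left heT₁⟩).not_ge hk

end LineChart

section Circle

open Filter Topology

/-- A nested intersection of compact connected sets is connected. -/
lemma isPreconnected_iInter_of_antitone {X : Type*} [TopologicalSpace X] [T2Space X] [NormalSpace X]
    {K : ℕ → Set X} (hK : Antitone K) (hc : ∀ n, IsCompact (K n))
    (hp : ∀ n, IsPreconnected (K n)) : IsPreconnected (⋂ n, K n) := by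
  rw [isPreconnected_iff_subset_of_fully_disjoint_closed
    (isClosed_iInter fun n => (hc n).isClosed)]
  intro u v hu hv huv hdis
  obtain ⟨U, V, hU, hV, huU, hvV, hUV⟩ := (normal_separation hu hv hdis)
  obtain ⟨n, hn⟩ := exists_subset_nhds_of_isCompact (V := K) hK.directed_ge hc
    (U := U ∪ V) fun x hx => (hU.union hV).mem_nhds (union_subset_union huU hvV (huv hx))
  have hsub : ⋂ n, K n ⊆ K n := iInter_subset _ _
  rcases (isPreconnected_iff_subset_of_disjoint.1 (hp n)) U V hU hV hn
    (by rw [hUV.inter_eq, inter_empty]) with h | h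
  · left
    intro x hx
    exact (huv hx).resolve_right fun hxv => hUV.le_bot ⟨h (hsub hx), hvV hxv⟩
  · right
    intro x hx
    exact (huv hx).resolve_left fun hxu => hUV.le_bot ⟨huU hxu, h (hsub hx)⟩

variable {M : Type*} [MetricSpace M]

/-- A locally injective curve in a one-dimensional manifold is open. -/
lemma image_mem_nhds_of_injOn (hch : ∀ z : M, ∃ β : ℝ → M, IsOpenEmbedding β ∧ β 0 = z)
    {φ : ℝ → M} (hφ : Continuous φ) {t δ : ℝ} (hδ : 0 < δ)
    (hinj : InjOn φ (Ioo (t - δ) (t + δ))) {V : Set ℝ} (hV : V ∈ 𝓝 t) : φ '' V ∈ 𝓝 (φ t) := by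
  obtain ⟨β, hβ, hβ0⟩ := hch (φ t)
  have hr : φ ⁻¹' range β ∈ 𝓝 t :=
    hφ.continuousAt (hβ.isOpen_range.mem_nhds ⟨0, hβ0⟩)
  obtain ⟨s, hs, hsub⟩ := Metric.nhds_basis_closedBall.mem_iff.1
    (inter_mem (inter_mem hr hV) (Ioo_mem_nhds (sub_lt_self t hδ) (lt_add_of_pos_right t hδ)))
  rw [Real.closedBall_eq_Icc] at hsub
  have hex : ∀ v ∈ Icc (t - s) (t + s), ∃ w, β w = φ v := fun v hv => (hsub hv).1.1
  choose! u hu using hex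
  have hts : t - s ≤ t + s := by linarith
  have hucont : ContinuousOn u (Icc (t - s) (t + s)) := by
    rw [hβ.isInducing.continuousOn_iff]
    exact hφ.continuousOn.congr fun v hv => hu v hv
  have huinj : InjOn u (Icc (t - s) (t + s)) := by
    intro v hv w hw h
    exact hinj (hsub hv).2 (hsub hw).2 (by rw [← hu v hv, ← hu w hw, h])
  have htm : t ∈ Icc (t - s) (t + s) := ⟨by linarith, by linarith⟩
  have hl : t - s ∈ Icc (t - s) (t + s) := ⟨le_rfl, hts⟩
  have hrr : t + s ∈ Icc (t - s) (t + s) := ⟨hts, le_rfl⟩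
  have hnhds : u '' Icc (t - s) (t + s) ∈ 𝓝 (u t) := by
    rcases hucont.strictMonoOn_of_injOn_Icc' hts huinj with h | h
    · exact mem_of_superset (Icc_mem_nhds (h hl htm (by linarith)) (h htm hrr (by linarith)))
        (intermediate_value_Icc hts hucont)
    · exact mem_of_superset (Icc_mem_nhds (h htm hrr (by linarith)) (h hl htm (by linarith)))
        (intermediate_value_Icc' hts hucont)
  have := hβ.isOpenMap.image_mem_nhds hnhds
  rw [hu t htm] at this
  refine mem_of_superset this ?_
  rintro _ ⟨_, ⟨v, hv, rfl⟩, rfl⟩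
  exact ⟨v, (hsub hv).1.2, (hu v hv).symm⟩

/-- Charts of a compact one-dimensional manifold can be chosen uniformly large. -/
lemma exists_uniform_charts [CompactSpace M]
    (hch : ∀ z : M, ∃ β : ℝ → M, IsOpenEmbedding β ∧ β 0 = z) :
    ∃ r > 0, ∀ z : M, ∃ β : ℝ → M, IsOpenEmbedding β ∧ β 0 = z ∧
      r ≤ dist z (β 1) ∧ r ≤ dist z (β (-1)) := by
  refine (isCompact_univ (X := M)).induction_on
    (p := fun A => ∃ r > 0, ∀ z ∈ A, ∃ β : ℝ → M, IsOpenEmbedding β ∧ β 0 = z ∧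
      r ≤ dist z (β 1) ∧ r ≤ dist z (β (-1))) ⟨1, one_pos, by simp⟩
    (fun A B hAB ⟨r, hr, h⟩ => ⟨r, hr, fun z hz => h z (hAB hz)⟩) ?_ ?_ |>.imp
      fun r h => ⟨h.1, fun z => h.2 z (mem_univ z)⟩
  · rintro A B ⟨r, hr, h⟩ ⟨r', hr', h'⟩
    refine ⟨min r r', lt_min hr hr', ?_⟩
    rintro z (hz | hz)
    · obtain ⟨β, h1, h2, h3, h4⟩ := h z hz
      exact ⟨β, h1, h2, (min_le_left _ _).trans h3, (min_le_left _ _).trans h4⟩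
    · obtain ⟨β, h1, h2, h3, h4⟩ := h' z hz
      exact ⟨β, h1, h2, (min_le_right _ _).trans h3, (min_le_right _ _).trans h4⟩
  · intro z _
    obtain ⟨β, hβ, rfl⟩ := hch z
    set r := min (dist (β 0) (β 1)) (dist (β 0) (β (-1))) with hr
    have hrpos : 0 < r := lt_min (dist_pos.2 (hβ.injective.ne (by norm_num)))
      (dist_pos.2 (hβ.injective.ne (by norm_num)))
    have hcont : ∀ c : ℝ, ∀ᶠ s in 𝓝 (0 : ℝ), r / 2 < dist (β s) (β (s + c)) ∨
        dist (β 0) (β c) ≤ r / 2 := by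
      intro c
      by_cases h : dist (β 0) (β c) ≤ r / 2
      · exact Eventually.of_forall fun _ => Or.inr h
      · have : Tendsto (fun s => dist (β s) (β (s + c))) (𝓝 0) (𝓝 (dist (β 0) (β (0 + c)))) := by
          have hc := hβ.continuous
          exact Continuous.tendsto (by fun_prop) 0
        rw [zero_add] at this
        filter_upwards [this.eventually_const_lt (not_le.1 h)] with s hs using Or.inl hs
    have hB : β '' {s | r / 2 ≤ dist (β s) (β (s + 1)) ∧ r / 2 ≤ dist (β s) (β (s + -1))} ∈
        𝓝 (β 0) := by
      refine hβ.isOpenMap.image_mem_nhds ?_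
      filter_upwards [hcont 1, hcont (-1)] with s h1 h2
      have := min_le_left (dist (β 0) (β 1)) (dist (β 0) (β (-1)))
      have := min_le_right (dist (β 0) (β 1)) (dist (β 0) (β (-1)))
      constructor
      · rcases h1 with h1 | h1 <;> linarith
      · rcases h2 with h2 | h2 <;> linarith
    refine ⟨_, mem_nhdsWithin_of_mem_nhds hB, r / 2, half_pos hrpos, ?_⟩
    rintro _ ⟨s, ⟨h1, h2⟩, rfl⟩
    exact ⟨fun v => β (s + v), hβ.comp (Homeomorph.addLeft s).isOpenEmbedding, by simp, h1, h2⟩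

/-- A compact one-dimensional manifold carries an endless curve. -/
lemma exists_endless_curve [CompactSpace M] [Nonempty M]
    (hch : ∀ z : M, ∃ β : ℝ → M, IsOpenEmbedding β ∧ β 0 = z) :
    ∃ r > 0, ∃ γ : ℝ → M, Continuous γ ∧ (∀ t, ∃ δ > 0, InjOn γ (Ioo (t - δ) (t + δ))) ∧
      ∀ n : ℕ, 1 ≤ n → r ≤ dist (γ n) (γ (n + 1)) := by
  obtain ⟨r, hr, huc⟩ := exists_uniform_charts hch
  refine ⟨r, hr, ?_⟩
  have hstep : ∀ β : {β : ℝ → M // IsOpenEmbedding β}, ∃ β' : {β : ℝ → M // IsOpenEmbedding β},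
      β'.1 0 = β.1 1 ∧ r ≤ dist (β'.1 0) (β'.1 1) ∧
      ∃ δ > 0, δ < 1 ∧ ∀ u ∈ Ioo (1 - δ) 1, β.1 u ∈ β'.1 '' Iio 0 := by
    rintro ⟨β, hβ⟩
    obtain ⟨β', hβ', h0, h1, h2⟩ := huc (β 1)
    have hr : β ⁻¹' range β' ∈ 𝓝 (1 : ℝ) :=
      hβ.continuous.continuousAt (hβ'.isOpen_range.mem_nhds ⟨0, h0⟩)
    obtain ⟨δ', hδ', hsub'⟩ := Metric.mem_nhds_iff.1 hr
    obtain ⟨δ, hδ, hδ1, hδ2⟩ : ∃ δ > 0, δ < 1 ∧ δ ≤ δ' :=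
      ⟨min δ' (1 / 2), by positivity, (min_le_right _ _).trans_lt (by norm_num), min_le_left _ _⟩
    have hsub : ∀ u ∈ Ioo (1 - δ) 1, β u ∈ range β' := by
      intro u hu
      refine hsub' ?_
      rw [Metric.mem_ball, Real.dist_eq, abs_lt]
      constructor <;> linarith [hu.1, hu.2]
    have hcov : β '' Ioo (1 - δ) 1 ⊆ β' '' Iio 0 ∪ β' '' Ioi 0 := by
      rintro _ ⟨u, hu, rfl⟩
      obtain ⟨w, hw⟩ := hsub u hu
      rcases lt_trichotomy w 0 with h | h | h
      · exact Or.inl ⟨w, h, hw⟩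
      · subst h
        exact absurd (hβ.injective (hw.symm.trans h0)) hu.2.ne
      · exact Or.inr ⟨w, h, hw⟩
    have hdisj : β' '' Iio 0 ∩ β' '' Ioi 0 = ∅ := by
      rw [← image_inter hβ'.injective, Iio_inter_Ioi, Ioo_self, image_empty]
    rcases (isPreconnected_iff_subset_of_disjoint.1
      (isPreconnected_Ioo.image β hβ.continuous.continuousOn)) _ _
      (hβ'.isOpenMap _ isOpen_Iio) (hβ'.isOpenMap _ isOpen_Ioi) hcov
      (by rw [hdisj, inter_empty]) with h | h
    · exact ⟨⟨β', hβ'⟩, h0, by simpa [h0] using h1, δ, hδ, hδ1, fun u hu => h ⟨u, hu, rfl⟩⟩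
    · refine ⟨⟨fun u => β' (-u), hβ'.comp (Homeomorph.neg ℝ).isOpenEmbedding⟩, by simpa using h0,
        by simpa [h0] using h2, δ, hδ, hδ1, fun u hu => ?_⟩
      obtain ⟨w, hw, hwu⟩ := h ⟨u, hu, rfl⟩
      exact ⟨-w, by simpa using hw, by simpa using hwu⟩
  choose next hnext0 hnext1 hnextδ using hstep
  obtain ⟨β₀, hβ₀, -⟩ := hch (Classical.arbitrary M)
  let B : ℕ → {β : ℝ → M // IsOpenEmbedding β} := fun n => next^[n] ⟨β₀, hβ₀⟩
  have hB : ∀ n, B (n + 1) = next (B n) := fun n => Function.iterate_succ_apply' _ _ _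
  let γ : ℝ → M := fun t => (B ⌊t⌋₊).1 (t - ⌊t⌋₊)
  have hγ0 : ∀ t < 1, γ t = (B 0).1 t := by
    intro t ht
    have : ⌊t⌋₊ = 0 := Nat.floor_eq_zero.2 ht
    simp only [γ, this]
    simp
  have hγn : ∀ n : ℕ, ∀ t, (n : ℝ) ≤ t → t < n + 1 → γ t = (B n).1 (t - n) := by
    intro n t h1 h2
    have : ⌊t⌋₊ = n := (Nat.floor_eq_iff (n.cast_nonneg.trans h1)).2 ⟨h1, h2⟩
    simp only [γ, this]
  have hlocal : ∀ t, (∃ n : ℕ, ∀ᶠ u in 𝓝 t, γ u = (B n).1 (u - n)) ∨ ∃ n : ℕ, t = n + 1 := by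
    intro t
    rcases lt_or_ge t 1 with ht | ht
    · left
      refine ⟨0, ?_⟩
      filter_upwards [Iio_mem_nhds ht] with u hu
      rw [hγ0 u hu]; simp
    · have h0 : 0 ≤ t := by linarith
      have h1 := Nat.floor_le h0
      have h2 := Nat.lt_floor_add_one t
      rcases h1.eq_or_lt with h | h
      · right
        refine ⟨⌊t⌋₊ - 1, ?_⟩
        have : 1 ≤ ⌊t⌋₊ := Nat.one_le_floor_iff t |>.2 ht
        push_cast [Nat.cast_sub this]
        linarith
      · left
        refine ⟨⌊t⌋₊, ?_⟩
        filter_upwards [Ioo_mem_nhds h h2] with u hu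
        exact hγn _ u hu.1.le hu.2
  have hleft : ∀ n : ℕ, ∀ u ∈ Ioo (n : ℝ) (n + 1), γ u = (B n).1 (u - n) :=
    fun n u hu => hγn n u hu.1.le hu.2
  have hright : ∀ n : ℕ, ∀ u ∈ Ico (n + 1 : ℝ) (n + 2), γ u = (B (n + 1)).1 (u - (n + 1)) := by
    intro n u hu
    have := hγn (n + 1) u (by push_cast; exact hu.1) (by push_cast; linarith [hu.2])
    simpa using this
  refine ⟨γ, ?_, ?_, ?_⟩
  · rw [continuous_iff_continuousAt]
    intro t
    rcases hlocal t with ⟨n, hn⟩ | ⟨n, rfl⟩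
    · refine ContinuousAt.congr ?_ (hn.mono fun _ => Eq.symm)
      exact ((B n).2.continuous.comp (continuous_id.sub continuous_const)).continuousAt
    · rw [continuousAt_iff_continuous_left_right]
      have hval : γ (n + 1) = (B n).1 (n + 1 - n) := by
        rw [hright n _ ⟨le_rfl, by linarith⟩, sub_self, hB, hnext0, add_sub_cancel_left]
      constructor
      · have hc : Continuous fun u : ℝ => (B n).1 (u - n) :=
          (B n).2.continuous.comp (continuous_id.sub continuous_const)
        refine hc.continuousWithinAt.congr_of_eventuallyEq ?_ hval
        filter_upwards [Ioc_mem_nhdsLE (show (n : ℝ) < n + 1 by linarith)] with u hu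
        rcases hu.2.eq_or_lt with rfl | h
        · exact hval
        · exact hleft n u ⟨hu.1, h⟩
      · have hc : Continuous fun u : ℝ => (B (n + 1)).1 (u - (n + 1)) :=
          (B (n + 1)).2.continuous.comp (continuous_id.sub continuous_const)
        refine hc.continuousWithinAt.congr_of_eventuallyEq ?_ (hright n _ ⟨le_rfl, by linarith⟩)
        filter_upwards [Ico_mem_nhdsGE (show (n : ℝ) + 1 < n + 2 by linarith)] with u hu
        exact hright n u hu
  · intro t
    rcases hlocal t with ⟨n, hn⟩ | ⟨n, rfl⟩
    · obtain ⟨δ, hδ, hsub⟩ := Metric.mem_nhds_iff.1 hn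
      refine ⟨δ, hδ, ?_⟩
      rw [← Real.ball_eq_Ioo]
      intro u hu v hv huv
      rw [hsub hu, hsub hv] at huv
      simpa using (B n).2.injective huv
    · obtain ⟨δ, hδ, hδ1, hsub⟩ := hnextδ (B n)
      rw [← hB] at hsub
      have hneg : ∀ u, (n : ℝ) + 1 - δ < u → u < n + 1 → γ u = (B n).1 (u - n) ∧
          γ u ∈ (B (n + 1)).1 '' Iio 0 := by
        intro u h1 h2
        have := hleft n u ⟨by linarith, h2⟩
        refine ⟨this, this ▸ hsub _ ⟨by linarith, by linarith⟩⟩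
      have hpos : ∀ u, (n : ℝ) + 1 ≤ u → u < n + 1 + δ → γ u = (B (n + 1)).1 (u - (n + 1)) :=
        fun u h1 h2 => hright n u ⟨h1, by linarith⟩
      have hcross : ∀ u v, (n : ℝ) + 1 - δ < u → u < n + 1 → (n : ℝ) + 1 ≤ v → v < n + 1 + δ →
          γ u ≠ γ v := by
        intro u v h1 h2 h3 h4 h
        obtain ⟨w, hw, hwu⟩ := (hneg u h1 h2).2
        rw [h, hpos v h3 h4] at hwu
        have := (B (n + 1)).2.injective hwu
        have hw' : w < 0 := hw
        linarith
      refine ⟨δ, hδ, fun u hu v hv huv => ?_⟩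
      rcases lt_or_ge u (n + 1) with h | h <;> rcases lt_or_ge v (n + 1) with h' | h'
      · rw [(hneg u hu.1 h).1, (hneg v hv.1 h').1] at huv
        simpa using (B n).2.injective huv
      · exact (hcross u v hu.1 h h' hv.2 huv).elim
      · exact (hcross v u hv.1 h' h hu.2 huv.symm).elim
      · rw [hpos u h hu.2, hpos v h' hv.2] at huv
        simpa using (B (n + 1)).2.injective huv
  · intro n hn
    obtain ⟨m, rfl⟩ := Nat.exists_eq_add_of_le' hn
    have h1 := hγn (m + 1) ((m + 1 : ℕ) : ℝ) le_rfl (by linarith)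
    have h2 := hγn (m + 1 + 1) ((m + 1 : ℕ) + 1 : ℝ) (by push_cast; linarith)
      (by push_cast; linarith)
    rw [h1, h2, sub_self]
    push_cast
    rw [sub_self, hB (m + 1), hnext0, hB m]
    exact hnext1 (B m)

/-- An endless curve in a compact one-dimensional manifold is not injective. -/
lemma not_injective_of_endless [CompactSpace M]
    (hch : ∀ z : M, ∃ β : ℝ → M, IsOpenEmbedding β ∧ β 0 = z)
    {γ : ℝ → M} (hγ : Continuous γ) {r : ℝ} (hr : 0 < r)
    (hstep : ∀ n : ℕ, 1 ≤ n → r ≤ dist (γ n) (γ (n + 1))) : ¬ Function.Injective γ := by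
  intro hinj
  have hopen : ∀ V, IsOpen V → IsOpen (γ '' V) := by
    intro V hV
    rw [isOpen_iff_mem_nhds]
    rintro _ ⟨t, ht, rfl⟩
    exact image_mem_nhds_of_injOn hch hγ one_pos hinj.injOn (hV.mem_nhds ht)
  set K : ℕ → Set M := fun n => closure (γ '' Ici (n : ℝ)) with hK
  have hanti : Antitone K := fun m n hmn =>
    closure_mono (image_mono (Ici_subset_Ici.2 (Nat.cast_le.2 hmn)))
  have hcomp : ∀ n, IsCompact (K n) := fun n => isClosed_closure.isCompact
  have hL : IsPreconnected (⋂ n, K n) := isPreconnected_iInter_of_antitone hanti hcomp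
    fun n => (isPreconnected_Ici.image γ hγ.continuousOn).closure
  have hLne : (⋂ n, K n).Nonempty := IsCompact.nonempty_iInter_of_sequence_nonempty_isCompact_isClosed
    K (fun n => hanti n.le_succ) (fun n => (nonempty_Ici.image γ).closure) (hcomp 0)
    (fun n => isClosed_closure)
  have hdisj : ∀ t, γ t ∉ ⋂ n, K n := by
    intro t ht
    obtain ⟨n, hn⟩ := exists_nat_gt (t + 1)
    obtain ⟨_, ⟨u, hu, rfl⟩, v, hv, huv⟩ := mem_closure_iff.1 (mem_iInter.1 ht n) _
      (hopen _ isOpen_Iio) ⟨t, (lt_add_one t : t ∈ Iio (t + 1)), rfl⟩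
    have h1 : u < t + 1 := hu
    have h2 : (n : ℝ) ≤ v := hv
    rw [hinj huv] at h2
    linarith
  obtain ⟨w, hw⟩ := hLne
  obtain ⟨y, hy, hyw⟩ : ∃ y ∈ ⋂ n, K n, y ≠ w := by
    by_contra! hsing
    obtain ⟨n, hn⟩ := exists_subset_nhds_of_isCompact (V := K) hanti.directed_ge hcomp
      (U := Metric.ball w (r / 2)) fun x hx => by
        rw [hsing x hx]; exact Metric.ball_mem_nhds _ (half_pos hr)
    have h1 : γ ((n + 1 : ℕ) : ℝ) ∈ Metric.ball w (r / 2) :=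
      hn (subset_closure ⟨_, by simp, rfl⟩)
    have h2 : γ ((n + 1 : ℕ) + 1 : ℝ) ∈ Metric.ball w (r / 2) :=
      hn (subset_closure ⟨_, by simp; linarith, rfl⟩)
    have h3 := hstep (n + 1) (by omega)
    rw [Metric.mem_ball] at h1 h2
    rw [dist_comm] at h2
    have := dist_triangle (γ ((n + 1 : ℕ) : ℝ)) w (γ ((n + 1 : ℕ) + 1 : ℝ))
    linarith
  obtain ⟨β, hβ, hβ0⟩ := hch w
  have hchart : IsLineChartAt univ w β :=
    ⟨hβ.isEmbedding, ⟨range β, hβ.isOpen_range, univ_inter _⟩, hβ0⟩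
  obtain ⟨a, b, hab, hsub⟩ := hchart.exists_image_Ioo_subset hL (subset_univ _) hw hy hyw
  have hmid : β ((a + b) / 2) ∈ β '' Ioo a b := ⟨_, ⟨by linarith, by linarith⟩, rfl⟩
  obtain ⟨_, hz, t, -, rfl⟩ := mem_closure_iff.1 (mem_iInter.1 (hsub hmid) 0) _
    (hβ.isOpenMap _ isOpen_Ioo) hmid
  exact hdisj t (hsub hz)

/-- A nonempty compact one-dimensional manifold contains an open embedded circle. -/
lemma exists_open_circle [CompactSpace M] [Nonempty M]
    (hch : ∀ z : M, ∃ β : ℝ → M, IsOpenEmbedding β ∧ β 0 = z) :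
    ∃ h : Circle → M, Continuous h ∧ Function.Injective h ∧ IsOpen (range h) := by
  obtain ⟨r, hr, γ, hγ, hloc, hstep⟩ := exists_endless_curve hch
  have hni := not_injective_of_endless hch hγ hr hstep
  obtain ⟨a, b, hab, hγab⟩ : ∃ a b, a < b ∧ γ a = γ b := by
    simp only [Function.Injective, not_forall] at hni
    obtain ⟨a, b, h1, h2⟩ := hni
    rcases lt_or_gt_of_ne h2 with h | h
    exacts [⟨a, b, h, h1⟩, ⟨b, a, h, h1.symm⟩]
  obtain ⟨δ, hδ, hunif⟩ : ∃ δ > 0, ∀ s ∈ Icc a b, ∀ t, |t - s| < δ → γ s = γ t → s = t := by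
    choose d hd hdinj using hloc
    obtain ⟨δ, hδ, h⟩ := lebesgue_number_lemma_of_metric (isCompact_Icc (a := a) (b := b))
      (c := fun x : ℝ => Ioo (x - d x) (x + d x)) (fun _ => isOpen_Ioo)
      (fun x _ => mem_iUnion.2 ⟨x, by linarith [hd x], by linarith [hd x]⟩)
    refine ⟨δ, hδ, fun s hs t hst hγst => ?_⟩
    obtain ⟨i, hi⟩ := h s hs
    exact hdinj i (hi (Metric.mem_ball_self hδ)) (hi (by rwa [Metric.mem_ball, Real.dist_eq])) hγst
  have hDc : IsCompact {p : ℝ × ℝ | p ∈ Icc a b ×ˢ Icc a b ∧ p.1 + δ ≤ p.2 ∧ γ p.1 = γ p.2} := by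
    refine (isCompact_Icc.prod isCompact_Icc).inter_right (IsClosed.inter ?_ ?_)
    · exact isClosed_le (continuous_fst.add continuous_const) continuous_snd
    · exact isClosed_eq (hγ.comp continuous_fst) (hγ.comp continuous_snd)
  have hfar : ∀ s ∈ Icc a b, ∀ t, s < t → γ s = γ t → s + δ ≤ t := by
    intro s hs t hst hγst
    by_contra! hlt
    exact hst.ne (hunif s hs t (by rw [abs_lt]; constructor <;> linarith) hγst)
  obtain ⟨⟨s, t⟩, ⟨⟨hs, ht⟩, hst, hγst⟩, hmin⟩ := hDc.exists_isMinOn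
    ⟨(a, b), ⟨⟨le_rfl, hab.le⟩, ⟨hab.le, le_rfl⟩⟩, hfar a ⟨le_rfl, hab.le⟩ b hab hγab, hγab⟩
    (f := fun p : ℝ × ℝ => p.2 - p.1) (by fun_prop)
  dsimp only at hs ht hst hγst
  have hlt : s < t := by linarith
  have hinj : InjOn γ (Ico s t) := by
    have : ∀ u ∈ Ico s t, ∀ v ∈ Ico s t, u < v → γ u ≠ γ v := by
      intro u hu v hv huv h
      have hu' : u ∈ Icc a b := ⟨hs.1.trans hu.1, hu.2.le.trans ht.2⟩
      have hv' : v ∈ Icc a b := ⟨hs.1.trans hv.1, hv.2.le.trans ht.2⟩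
      have hle : t - s ≤ v - u :=
        isMinOn_iff.1 hmin (u, v) ⟨⟨hu', hv'⟩, hfar u hu' v huv h, h⟩
      linarith [hu.1, hv.2]
    intro u hu v hv h
    by_contra hne
    rcases lt_or_gt_of_ne hne with h' | h'
    exacts [this u hu v hv h' h, this v hv u hu h' h.symm]
  set p := t - s with hp
  have hp0 : 0 < p := by linarith
  have : Fact (0 < p) := ⟨hp0⟩
  have hsp : s + p = t := by linarith
  let h : AddCircle p → M := AddCircle.liftIco p s γ
  have hcont : Continuous h :=
    AddCircle.liftIco_continuous (by rw [hsp]; exact hγst) hγ.continuousOn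
  have hhinj : Function.Injective h := by
    intro x y hxy
    obtain ⟨u, hu, rfl⟩ := (AddCircle.coe_image_Ico_eq p s).ge (mem_univ x)
    obtain ⟨v, hv, rfl⟩ := (AddCircle.coe_image_Ico_eq p s).ge (mem_univ y)
    simp only [h] at hxy
    rw [AddCircle.liftIco_coe_apply hu, AddCircle.liftIco_coe_apply hv] at hxy
    rw [hsp] at hu hv
    rw [hinj hu hv hxy]
  have hopen : IsOpen (range h) := by
    rw [isOpen_iff_mem_nhds]
    rintro _ ⟨x, rfl⟩
    obtain ⟨u, rfl⟩ := QuotientAddGroup.mk_surjective x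
    refine mem_of_superset (image_mem_nhds_of_injOn hch (φ := fun v : ℝ => h (v : AddCircle p))
      (hcont.comp (AddCircle.continuous_mk' p)) (half_pos hp0) (t := u) ?_ univ_mem) ?_
    · intro v hv w hw hvw
      exact (AddCircle.coe_eq_coe_iff_of_mem_Ico (a := u - p / 2)
        ⟨hv.1.le, by linarith [hv.2]⟩ ⟨hw.1.le, by linarith [hw.2]⟩).1 (hhinj hvw)
    · rintro _ ⟨v, -, rfl⟩
      exact mem_range_self _
  let e := AddCircle.homeomorphCircle hp0.ne'
  refine ⟨h ∘ e.symm, hcont.comp e.symm.continuous, hhinj.comp e.symm.injective, ?_⟩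
  rwa [e.symm.surjective.range_comp]

end Circle

section MinimalSet

open Filter Topology

variable {W : Type*} [NormedAddCommGroup W] {g : W ≃ₜ W} {C K : Set W}

namespace IsMinimalSet

lemma apply_mem_iff (h : IsMinimalSet g C) (x : W) : g x ∈ C ↔ x ∈ C := by
  conv_lhs => rw [← h.2.2.1]
  exact g.injective.mem_set_image

lemma iterate_mem (h : IsMinimalSet g C) {x : W} (hx : x ∈ C) (n : ℕ) : g^[n] x ∈ C := by
  induction n with
  | zero => exact hx
  | succ n ih => rw [Function.iterate_succ_apply']; exact (h.apply_mem_iff _).2 ih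

lemma eq_of_image_subset (h : IsMinimalSet g C) (hKC : K ⊆ C) (hne : K.Nonempty)
    (hK : IsClosed K) (hgK : g '' K ⊆ K) : K = C := by
  have hcont : ∀ n, Continuous g^[n] := fun n => g.continuous.iterate n
  have hKc : IsCompact K := h.2.1.of_isClosed_subset hK hKC
  have hanti : ∀ n, g^[n + 1] '' K ⊆ g^[n] '' K := by
    intro n
    rw [Function.iterate_succ, image_comp]
    exact image_mono hgK
  have hinv : g '' (⋂ n, g^[n] '' K) = ⋂ n, g^[n] '' K := by
    rw [image_iInter g.bijective]
    simp_rw [← image_comp, ← Function.iterate_succ']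
    exact subset_antisymm (subset_iInter fun n => (iInter_subset _ n).trans (hanti n))
      (subset_iInter fun n => iInter_subset (fun n => g^[n] '' K) (n + 1))
  have hsub : ⋂ n, g^[n] '' K ⊆ K := (iInter_subset _ 0).trans (by simp)
  refine subset_antisymm hKC ?_
  rw [← h.2.2.2 _ (hsub.trans hKC) ?_ ?_ hinv]
  · exact hsub
  · exact IsCompact.nonempty_iInter_of_sequence_nonempty_isCompact_isClosed _ hanti
      (fun n => hne.image _) (hKc.image (hcont 0)) fun n => (hKc.image (hcont n)).isClosed
  · exact isClosed_iInter fun n => (hKc.image (hcont n)).isClosed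

lemma symm (h : IsMinimalSet g C) : IsMinimalSet g.symm C := by
  have key : ∀ D : Set W, g.symm '' D = D → g '' D = D := fun D hD => by
    conv_lhs => rw [← hD]
    simp [← image_comp]
  refine ⟨h.1, h.2.1, ?_, fun D hDC hD hDc hgD => h.2.2.2 D hDC hD hDc (key D hgD)⟩
  conv_lhs => rw [← h.2.2.1]
  simp [← image_comp]

lemma isPeriodicOrbitSet (h : IsMinimalSet g C) {x : W} (hx : x ∈ C) {n : ℕ} (hn : 0 < n)
    (hper : g^[n] x = x) : IsPeriodicOrbitSet g C := by
  refine ⟨x, n, hn, hper, Eq.symm (h.eq_of_image_subset ?_ ⟨x, 0, rfl⟩ ?_ ?_)⟩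
  · rintro _ ⟨k, rfl⟩
    exact h.iterate_mem hx k
  · refine (((finite_lt_nat n).image fun k => g^[k] x).subset ?_).isClosed
    rintro _ ⟨k, rfl⟩
    exact ⟨k % n, Nat.mod_lt k hn, Function.IsPeriodicPt.iterate_mod_apply hper k⟩
  · rintro _ ⟨_, ⟨k, rfl⟩, rfl⟩
    exact ⟨k + 1, (Function.iterate_succ_apply' _ _ _).symm⟩

lemma isPeriodicOrbitSet_of_not_accPt (h : IsMinimalSet g C) {x : W} (hx : x ∈ C)
    (hacc : ¬ AccPt x (𝓟 C)) : IsPeriodicOrbitSet g C := by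
  rw [accPt_iff_nhds] at hacc
  push Not at hacc
  obtain ⟨U, hU, hUC⟩ := hacc
  have hK : closure (range fun k => g^[k + 1] x) = C := by
    refine h.eq_of_image_subset ?_ ⟨_, subset_closure ⟨0, rfl⟩⟩ isClosed_closure ?_
    · refine closure_minimal ?_ h.2.1.isClosed
      rintro _ ⟨k, rfl⟩
      exact h.iterate_mem hx _
    · rw [g.image_closure]
      refine closure_mono ?_
      rintro _ ⟨_, ⟨k, rfl⟩, rfl⟩
      exact ⟨k + 1, Function.iterate_succ_apply' _ _ _⟩
  obtain ⟨_, hyU, k, rfl⟩ := mem_closure_iff_nhds.1 (hK.ge hx) U hU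
  exact h.isPeriodicOrbitSet hx k.succ_pos (hUC _ ⟨hyU, h.iterate_mem hx _⟩)

end IsMinimalSet

/-- Every nonempty compact forward invariant set contains a minimal set. -/
lemma exists_isMinimalSet_subset (hK : IsCompact K) (hne : K.Nonempty) (hgK : g '' K ⊆ K) :
    ∃ C ⊆ K, IsMinimalSet g C := by
  set S := {D : Set W | D ⊆ K ∧ D.Nonempty ∧ IsClosed D ∧ g '' D ⊆ D}
  have hS : ∀ c ⊆ S, IsChain (· ⊆ ·) c → c.Nonempty → ∃ lb ∈ S, ∀ s ∈ c, lb ⊆ s := by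
    intro c hc hchain hcne
    refine ⟨⋂₀ c, ⟨?_, ?_, ?_, ?_⟩, fun s hs => sInter_subset_of_mem hs⟩
    · obtain ⟨s, hs⟩ := hcne
      exact (sInter_subset_of_mem hs).trans (hc hs).1
    · have := hcne.to_subtype
      exact IsCompact.nonempty_sInter_of_directed_nonempty_isCompact_isClosed
        (fun a ha b hb => (hchain.total ha hb).elim (fun h => ⟨a, ha, Subset.rfl, h⟩)
          fun h => ⟨b, hb, h, Subset.rfl⟩) (fun s hs => (hc hs).2.1)
        (fun s hs => hK.of_isClosed_subset (hc hs).2.2.1 (hc hs).1) (fun s hs => (hc hs).2.2.1)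
    · exact isClosed_sInter fun s hs => (hc hs).2.2.1
    · exact subset_sInter fun s hs =>
        (image_mono (sInter_subset_of_mem hs)).trans (hc hs).2.2.2
  obtain ⟨C, hCK, hC⟩ := zorn_superset_nonempty S hS K ⟨Subset.rfl, hne, hK.isClosed, hgK⟩
  obtain ⟨-, hCne, hCc, hgC⟩ := hC.prop
  have hCcomp : IsCompact C := hK.of_isClosed_subset hCc hCK
  refine ⟨C, hCK, hCne, hCcomp, ?_, fun D hDC hD hDc hgD => ?_⟩
  · exact subset_antisymm hgC (hC.le_of_le ⟨hgC.trans hCK, hCne.image g,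
      (hCcomp.image g.continuous).isClosed, image_mono hgC⟩ hgC)
  · exact subset_antisymm hDC (hC.le_of_le ⟨hDC.trans hCK, hD, hDc, hgD.le⟩ hDC)

end MinimalSet

section LocalGraph

open Filter Topology

namespace IsLineChartAt

/-- Restrict and reparametrize a chart by an interval around `0`. -/
lemma exists_range_subset {X : Type*} [TopologicalSpace X] {S U : Set X} {z : X} {β : ℝ → X}
    (h : IsLineChartAt S z β) (hU : U ∈ 𝓝 z) : ∃ β', IsLineChartAt S z β' ∧ range β' ⊆ U := by
  have : β ⁻¹' U ∈ 𝓝 (0 : ℝ) := h.continuous.continuousAt (by rwa [h.2.2])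
  obtain ⟨s, hs, hsub⟩ := Metric.mem_nhds_iff.1 this
  have he := (OpenPartialHomeomorph.univBall (0 : ℝ) s).isOpenEmbedding
    (OpenPartialHomeomorph.univBall_source _ _)
  have hr : range (OpenPartialHomeomorph.univBall (0 : ℝ) s) = Metric.ball 0 s := by
    rw [← image_univ, ← OpenPartialHomeomorph.univBall_source (0 : ℝ) s,
      OpenPartialHomeomorph.image_source_eq_target, OpenPartialHomeomorph.univBall_target _ hs]
  obtain ⟨O, hO, hSO⟩ := h.exists_isOpen_image (Metric.isOpen_ball (x := (0 : ℝ)) (ε := s))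
  refine ⟨β ∘ OpenPartialHomeomorph.univBall (0 : ℝ) s, ⟨h.1.comp he.isEmbedding,
    ⟨O, hO, by rw [hSO, range_comp, hr]⟩, ?_⟩, ?_⟩
  · simp [OpenPartialHomeomorph.univBall_apply_zero, h.2.2]
  · rw [range_comp, hr]
    exact image_subset_iff.2 hsub

end IsLineChartAt

variable {W : Type*} [NormedAddCommGroup W] [NormedSpace ℝ W]

/-- A `C¹` curve is locally the image of a `C¹` section `h` of a linear form `u`. -/
lemma IsC1SubmanifoldAt.exists_section [FiniteDimensional ℝ W] {S : Set W} {z : W}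
    (hS : IsC1SubmanifoldAt 1 S z) : ∃ (h : ℝ → W) (u : W →L[ℝ] ℝ) (U : Set W),
      ContDiff ℝ 1 h ∧ (∀ t, u (h t) = t) ∧ IsOpen U ∧ z ∈ U ∧
      ∀ x ∈ U, x ∈ S ↔ h (u x) = x := by
  obtain ⟨P, Q, ψ, U, hP, hPQ, hψ, hU, hz, hSU⟩ := hS
  let e : ℝ ≃L[ℝ] P := ContinuousLinearEquiv.ofFinrankEq (by simp [hP])
  let p : W →L[ℝ] P := LinearMap.toContinuousLinearMap (P.projectionOnto Q hPQ)
  have hp : ∀ q : P, p ((q : W) + (ψ q : W)) = q := by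
    intro q
    simp only [p, map_add, LinearMap.coe_toContinuousLinearMap',
      Submodule.projectionOnto_apply_left, Submodule.projectionOnto_apply_right, add_zero]
  refine ⟨fun t => (e t : W) + (ψ (e t) : W), (e.symm : P →L[ℝ] ℝ).comp p, U, ?_, ?_, hU, hz, ?_⟩
  · exact (P.subtypeL.contDiff.comp e.contDiff).add (hψ.comp e.contDiff)
  · intro t
    simp [hp]
  · intro x hx
    have h1 : x ∈ S ↔ ∃ q : P, x = (q : W) + (ψ q : W) :=
      ⟨fun h => (hSU.le ⟨h, hx⟩).2, fun h => (hSU.ge ⟨hx, h⟩).1⟩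
    rw [h1]
    constructor
    · rintro ⟨q, rfl⟩
      simp [hp]
    · intro h
      exact ⟨_, h.symm⟩

lemma IsC1SubmanifoldAt.exists_isLineChartAt [FiniteDimensional ℝ W] {S : Set W} {z : W}
    (hS : IsC1SubmanifoldAt 1 S z) (hz : z ∈ S) : ∃ β, IsLineChartAt S z β := by
  obtain ⟨h, u, U, hh, hu, hU, hzU, hSU⟩ := hS.exists_section
  have hhz : h (u z) = z := (hSU z hzU).1 hz
  have hpre : h ⁻¹' U ∈ 𝓝 (u z) := hh.continuous.continuousAt (hU.mem_nhds (by rwa [hhz]))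
  obtain ⟨s, hs, hsub⟩ := Metric.mem_nhds_iff.1 hpre
  have he := (OpenPartialHomeomorph.univBall (u z) s).isOpenEmbedding
    (OpenPartialHomeomorph.univBall_source _ _)
  have hr : range (OpenPartialHomeomorph.univBall (u z) s) = Metric.ball (u z) s := by
    rw [← image_univ, ← OpenPartialHomeomorph.univBall_source (u z) s,
      OpenPartialHomeomorph.image_source_eq_target, OpenPartialHomeomorph.univBall_target _ hs]
  have hhe : IsEmbedding h := IsEmbedding.of_leftInverse hu u.continuous hh.continuous
  refine ⟨h ∘ OpenPartialHomeomorph.univBall (u z) s, hhe.comp he.isEmbedding,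
    ⟨U ∩ u ⁻¹' Metric.ball (u z) s, hU.inter (Metric.isOpen_ball.preimage u.continuous), ?_⟩, ?_⟩
  · rw [range_comp, hr]
    ext x
    constructor
    · rintro ⟨hxS, hxU, hxu⟩
      exact ⟨u x, hxu, (hSU x hxU).1 hxS⟩
    · rintro ⟨t, ht, rfl⟩
      exact ⟨(hSU _ (hsub ht)).2 (by rw [hu]), hsub ht, by rwa [mem_preimage, hu]⟩
  · simp [OpenPartialHomeomorph.univBall_apply_zero, hhz]

end LocalGraph

section Classification

open Filter Topology

variable {W : Type*} [NormedAddCommGroup W] {g : W ≃ₜ W} {C S V : Set W}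

/-- A minimal subset of a locally invariant set is either open in it or nowhere open in it. -/
lemma IsMinimalSet.mem_nhdsWithin_or (h : IsMinimalSet g C) (hV : IsOpen V) (hCV : C ⊆ V)
    (hgS : ∀ x ∈ S ∩ V, g.symm x ∈ S) :
    (∀ x ∈ C, C ∈ 𝓝[S] x) ∨ ∀ x ∈ C, C ∉ 𝓝[S] x := by
  by_contra! hcon
  obtain ⟨⟨x, hx, hxC⟩, y, hy, hyC⟩ := hcon
  have hclosed : IsClosed (C ∩ {x | C ∉ 𝓝[S] x}) := by
    refine h.2.1.isClosed.inter (isOpen_compl_iff.1 ?_)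
    refine isOpen_iff_mem_nhds.2 fun z hz => ?_
    have hz' : C ∈ 𝓝[S] z := not_not.1 hz
    filter_upwards [eventually_nhds_nhdsWithin.2 hz'] with w hw using not_not.2 hw
  have hinv : g.symm '' (C ∩ {x | C ∉ 𝓝[S] x}) ⊆ C ∩ {x | C ∉ 𝓝[S] x} := by
    rintro _ ⟨z, ⟨hzC, hz⟩, rfl⟩
    refine ⟨(h.symm.apply_mem_iff z).2 hzC, fun hgz => hz ?_⟩
    have ht : Tendsto g.symm (𝓝[S] z) (𝓝[S] (g.symm z)) := by
      refine tendsto_nhdsWithin_iff.2 ⟨g.symm.continuous.continuousAt.mono_left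
        nhdsWithin_le_nhds, ?_⟩
      filter_upwards [self_mem_nhdsWithin, mem_nhdsWithin_of_mem_nhds (hV.mem_nhds (hCV hzC))]
        with w h1 h2 using hgS w ⟨h1, h2⟩
    filter_upwards [ht hgz] with w hw using (h.symm.apply_mem_iff w).1 hw
  have := h.symm.eq_of_image_subset inter_subset_left ⟨x, hx, hxC⟩ hclosed hinv
  exact (this.ge hy).2 hyC

lemma isTotallyDisconnected_of_notMem_nhdsWithin (hCS : C ⊆ S)
    (hch : ∀ c ∈ C, ∃ β, IsLineChartAt S c β) (hC : ∀ x ∈ C, C ∉ 𝓝[S] x) :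
    IsTotallyDisconnected C := by
  intro T hTC hT x hx y hy
  by_contra hxy
  obtain ⟨β, hβ⟩ := hch x (hTC hx)
  obtain ⟨a, b, hab, hsub⟩ :=
    hβ.exists_image_Ioo_subset hT (hTC.trans hCS) hx hy (Ne.symm hxy)
  obtain ⟨O, hO, hSO⟩ := hβ.exists_isOpen_image (isOpen_Ioo (a := a) (b := b))
  obtain ⟨u, hu⟩ := nonempty_Ioo.2 hab
  refine hC (β u) (hTC (hsub ⟨u, hu, rfl⟩)) ?_
  filter_upwards [self_mem_nhdsWithin,
    mem_nhdsWithin_of_mem_nhds (hO.mem_nhds (hSO.ge ⟨u, hu, rfl⟩).2)] with w h1 h2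
  exact hTC (hsub (hSO.le ⟨h1, h2⟩))

/-- A compact set open in a curve contains a circle open in it. -/
lemma exists_open_circle_of_mem_nhdsWithin (hne : C.Nonempty) (hC : IsCompact C) (hCS : C ⊆ S)
    (hch : ∀ c ∈ C, ∃ β, IsLineChartAt S c β) (hop : ∀ x ∈ C, C ∈ 𝓝[S] x) :
    ∃ φ : Circle → W, Continuous φ ∧ Function.Injective φ ∧ ∃ O, IsOpen O ∧ C ∩ O = range φ := by
  have := isCompact_iff_compactSpace.1 hC
  have := hne.to_subtype
  have hchart : ∀ z : C, ∃ β : ℝ → C, IsOpenEmbedding β ∧ β 0 = z := by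
    rintro ⟨z, hz⟩
    obtain ⟨β, hβ⟩ := hch z hz
    obtain ⟨U, hU, hUC⟩ := mem_nhdsWithin_iff_exists_mem_nhds_inter.1 (hop z hz)
    obtain ⟨β', hβ', hr⟩ := hβ.exists_range_subset hU
    have hmem : ∀ t, β' t ∈ C := fun t => hUC ⟨hr (mem_range_self t), hβ'.mem t⟩
    obtain ⟨O, hO, hSO⟩ := hβ'.2.1
    refine ⟨codRestrict β' C hmem, ⟨hβ'.1.codRestrict C hmem, ?_⟩, Subtype.ext hβ'.2.2⟩
    convert hO.preimage continuous_subtype_val using 1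
    ext w
    constructor
    · rintro ⟨t, rfl⟩
      exact (hSO.ge ⟨t, rfl⟩).2
    · intro hw
      obtain ⟨t, ht⟩ := hSO.le ⟨hCS w.2, hw⟩
      exact ⟨t, Subtype.ext ht⟩
  obtain ⟨φ, hφ, hinj, hopen⟩ := exists_open_circle hchart
  obtain ⟨O, hO, hOr⟩ := isOpen_induced_iff.1 hopen
  refine ⟨fun t => φ t, continuous_subtype_val.comp hφ, Subtype.val_injective.comp hinj, O, hO, ?_⟩
  rw [← Subtype.image_preimage_coe, hOr, ← range_comp]
  rfl

lemma IsPreconnected.subset_of_inter_isOpen {X : Type*} [TopologicalSpace X] {A B C O : Set X}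
    (hA : IsPreconnected A) (hAC : A ⊆ C) (hB : IsClosed B) (hO : IsOpen O) (hCO : C ∩ O = B)
    (hAB : (A ∩ B).Nonempty) : A ⊆ B := by
  intro a ha
  by_contra haB
  obtain ⟨x, hxA, hxO, hxB⟩ := hA O Bᶜ hO hB.isOpen_compl
    (fun x hx => or_iff_not_imp_right.2 fun h => (hCO.ge (not_not.1 h)).2)
    (hAB.mono fun x hx => ⟨hx.1, (hCO.ge hx.2).2⟩) ⟨a, ha, haB⟩
  exact hxB (hCO.le ⟨hAC hxA, hxO⟩)

lemma IsMinimalSet.isPeriodicCircleSet (h : IsMinimalSet g C) (hCS : C ⊆ S)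
    (hch : ∀ c ∈ C, ∃ β, IsLineChartAt S c β) (hop : ∀ x ∈ C, C ∈ 𝓝[S] x) :
    IsPeriodicCircleSet g C := by
  obtain ⟨φ, hφ, hφi, O, hO, hCO⟩ :=
    exists_open_circle_of_mem_nhdsWithin h.1 h.2.1 hCS hch hop
  set T : ℕ → Set W := fun k => range (g^[k] ∘ φ)
  have hcont : ∀ k, Continuous (g^[k] ∘ φ) := fun k => (g.continuous.iterate k).comp hφ
  have hTg : ∀ k, g '' T k = T (k + 1) := fun k => by
    simp only [T, ← range_comp, Function.iterate_succ', Function.comp_assoc]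
  have hTO : ∀ k, ∃ O, IsOpen O ∧ C ∩ O = T k := by
    intro k
    induction k with
    | zero => exact ⟨O, hO, hCO⟩
    | succ k ih =>
      obtain ⟨O, hO, hCO⟩ := ih
      exact ⟨g '' O, g.isOpenMap _ hO, by
        rw [← hTg, ← hCO, image_inter g.injective, h.2.2.1]⟩
  choose P hP hCP using hTO
  have hTC : ∀ k, T k ⊆ C := fun k => (hCP k).ge.trans inter_subset_left
  have hTcl : ∀ k, IsClosed (T k) := fun k => (isCompact_range (hcont k)).isClosed
  have hTconn : ∀ k, IsPreconnected (T k) := fun k =>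
    isPreconnected_range (hcont k)
  have hcov : C ⊆ ⋃ k, P k := by
    by_contra hcon
    have hmem : ∀ x ∈ C, ∀ k, x ∈ P k ↔ x ∈ T k := fun x hx k =>
      ⟨fun hxP => (hCP k).le ⟨hx, hxP⟩, fun hxT => ((hCP k).ge hxT).2⟩
    have hK : C \ ⋃ k, P k = C := by
      refine h.symm.eq_of_image_subset sdiff_subset (sdiff_nonempty.2 hcon)
        (h.2.1.isClosed.sdiff (isOpen_iUnion hP)) ?_
      rintro _ ⟨x, ⟨hxC, hx⟩, rfl⟩
      have hgx := (h.symm.apply_mem_iff x).2 hxC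
      refine ⟨hgx, fun hgP => hx ?_⟩
      obtain ⟨k, hk⟩ := mem_iUnion.1 hgP
      refine mem_iUnion.2 ⟨k + 1, (hmem x hxC _).2 ?_⟩
      rw [← hTg]
      exact ⟨_, (hmem _ hgx k).1 hk, g.apply_symm_apply x⟩
    have h0 : φ 1 ∈ T 0 := ⟨1, rfl⟩
    exact (hK.ge (hTC 0 h0)).2 (mem_iUnion.2 ⟨0, ((hCP 0).ge h0).2⟩)
  obtain ⟨t, ht⟩ := h.2.1.elim_finite_subcover P hP hcov
  obtain ⟨n, hn⟩ := t.exists_nat_subset_range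
  have hCn : ∀ x ∈ C, ∃ k < n + 1, x ∈ T k := by
    intro x hx
    obtain ⟨k, hk, hxk⟩ := mem_iUnion₂.1 (ht hx)
    exact ⟨k, (Finset.mem_range.1 (hn hk)).trans n.lt_succ_self, (hCP k).le ⟨hx, hxk⟩⟩
  refine ⟨n + 1, fun i => T i, n.succ_pos, fun i => ?_, ?_, fun i => ?_⟩
  · have he := (hcont i).isClosedEmbedding ((g.injective.iterate i).comp hφi)
    exact ⟨he.isEmbedding.toHomeomorph.symm.trans (Homeomorph.refl Circle)⟩
  · refine subset_antisymm (iUnion_subset fun i => hTC i) fun x hx => ?_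
    obtain ⟨k, hk, hxk⟩ := hCn x hx
    exact mem_iUnion.2 ⟨⟨k, hk⟩, hxk⟩
  · rw [hTg]
    have hx : (g^[i + 1] ∘ φ) 1 ∈ T (i + 1) := ⟨1, rfl⟩
    obtain ⟨k, hk, hxk⟩ := hCn _ (hTC _ hx)
    refine ⟨⟨k, hk⟩, subset_antisymm ?_ ?_⟩
    · exact (hTconn _).subset_of_inter_isOpen (hTC _) (hTcl _) (hP k) (hCP k) ⟨_, hx, hxk⟩
    · exact (hTconn _).subset_of_inter_isOpen (hTC _) (hTcl _) (hP _) (hCP _) ⟨_, hxk, hx⟩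

/-- Minimal subsets of a locally invariant curve are periodic orbits, periodic circles or
Cantor sets. -/
lemma IsMinimalSet.classification (h : IsMinimalSet g C) (hCS : C ⊆ S)
    (hch : ∀ c ∈ C, ∃ β, IsLineChartAt S c β) (hV : IsOpen V) (hCV : C ⊆ V)
    (hgS : ∀ x ∈ S ∩ V, g.symm x ∈ S) :
    IsPeriodicOrbitSet g C ∨ IsPeriodicCircleSet g C ∨ IsCantorSet' C := by
  by_cases hacc : ∀ x ∈ C, AccPt x (𝓟 C)
  · refine Or.inr ((h.mem_nhdsWithin_or hV hCV hgS).imp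
      (h.isPeriodicCircleSet hCS hch) fun hno => ?_)
    exact ⟨h.2.1, ⟨h.2.1.isClosed, hacc⟩, isTotallyDisconnected_of_notMem_nhdsWithin hCS hch hno⟩
  · push Not at hacc
    obtain ⟨x, hx, hxC⟩ := hacc
    exact Or.inl (h.isPeriodicOrbitSet_of_not_accPt hx hxC)

/-- A minimal set of a locally invariant curve which is approximated by periodic orbits is a
periodic orbit. -/
lemma IsMinimalSet.isPeriodicOrbitSet_of_approx (h : IsMinimalSet g C) (hCS : C ⊆ S)
    (hch : ∀ c ∈ C, ∃ β, IsLineChartAt S c β) (hV : IsOpen V) (hCV : C ⊆ V)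
    (hgS : ∀ x ∈ S ∩ V, g.symm x ∈ S)
    (happ : ∀ ε : ℝ, 0 < ε → ∃ x ∈ S, ∃ n : ℕ, 0 < n ∧ g^[n] x = x ∧
      Metric.hausdorffDist C {y | ∃ k : ℕ, y = g^[k] x} < ε) : IsPeriodicOrbitSet g C := by
  by_contra hcon
  have hnp : ∀ x ∈ C, ∀ n, 0 < n → g.symm^[n] x ≠ x := fun x hx n hn hper => by
    refine hcon (h.isPeriodicOrbitSet hx hn ?_)
    conv_lhs => rw [← hper]
    exact (Function.LeftInverse.iterate g.apply_symm_apply n) x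
  obtain ⟨ε, hε, hthick⟩ := exists_thickening_no_periodic g.symm.continuous g.symm.injective
    h.2.1 hCS hch h.symm.apply_mem_iff hnp hV hCV hgS
  obtain ⟨η, hη, hηV⟩ := h.2.1.exists_thickening_subset_open hV hCV
  obtain ⟨x, hxS, n, hn, hper, hd⟩ := happ (min ε η) (lt_min hε hη)
  have hfin : {y | ∃ k : ℕ, y = g^[k] x}.Finite := by
    refine ((finite_lt_nat n).image fun k => g^[k] x).subset ?_
    rintro _ ⟨k, rfl⟩
    exact ⟨k % n, Nat.mod_lt k hn, Function.IsPeriodicPt.iterate_mod_apply hper k⟩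
  have hnear : ∀ k, g^[k] x ∈ Metric.thickening (min ε η) C := by
    intro k
    obtain ⟨c, hc, hdc⟩ := Metric.exists_dist_lt_of_hausdorffDist_lt'
      (show g^[k] x ∈ {y | ∃ k : ℕ, y = g^[k] x} from ⟨k, rfl⟩) hd
      (Metric.hausdorffEDist_ne_top_of_nonempty_of_bounded h.1 ⟨x, 0, rfl⟩
        h.2.1.isBounded hfin.isBounded)
    exact Metric.mem_thickening_iff.2 ⟨c, hc, by rwa [dist_comm]⟩
  have horb : ∀ k, ∃ j, g.symm^[k] x = g^[j] x := by
    intro k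
    refine ⟨n * k - k, ?_⟩
    have h1 : g^[k] (g^[n * k - k] x) = x := by
      rw [← Function.iterate_add_apply, Nat.add_sub_cancel' (Nat.le_mul_of_pos_left k hn)]
      exact Function.IsPeriodicPt.mul_const hper k
    conv_lhs => rw [← h1]
    exact (Function.LeftInverse.iterate g.symm_apply_apply k) _
  have hnear' : ∀ k, g.symm^[k] x ∈ Metric.thickening (min ε η) C := fun k => by
    obtain ⟨j, hj⟩ := horb k
    exact hj ▸ hnear j
  refine hthick x n hn ?_ fun k => ⟨?_, Metric.thickening_mono (min_le_left _ _) _ (hnear' k)⟩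
  · conv_lhs => rw [← hper]
    exact (Function.LeftInverse.iterate g.symm_apply_apply n) x
  · induction k with
    | zero => exact hxS
    | succ k ih =>
      rw [Function.iterate_succ_apply']
      exact hgS _ ⟨ih, hηV (Metric.thickening_mono (min_le_right _ _) _ (hnear' k))⟩

end Classification

section Hyperbolic

open Filter Topology

lemma HasDerivAt.eventually_norm_sub_lt {E F : Type*} [NormedAddCommGroup E] [NormedSpace ℝ E]
    [NormedAddCommGroup F] [NormedSpace ℝ F] {f : ℝ → E} {k : ℝ → F} {v : E} {w : F} {t₀ : ℝ}
    (hf : HasDerivAt f v t₀) (hk : HasDerivAt k w t₀) (hvw : ‖v‖ < ‖w‖) :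
    ∀ᶠ t in 𝓝[≠] t₀, ‖f t - f t₀‖ < ‖k t - k t₀‖ := by
  filter_upwards [(hasDerivAt_iff_tendsto_slope.1 hf).norm.eventually_lt
    (hasDerivAt_iff_tendsto_slope.1 hk).norm hvw, self_mem_nhdsWithin] with t ht htne
  rw [slope_def_module, slope_def_module, norm_smul, norm_smul] at ht
  exact lt_of_mul_lt_mul_left ht (norm_nonneg _)

/-- A map which strictly decreases the distance to its fixed point `x` has no other periodic
point near `x`. -/
lemma eq_of_iterate_eq_of_dist_lt {X : Type*} [MetricSpace X] {G : X → X} {A : Set X} {x : X}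
    {δ : ℝ} (hGx : G x = x) (hGA : MapsTo G A A)
    (hG : ∀ y ∈ A, y ≠ x → dist y x < δ → dist (G y) x < dist y x) {p : X} (hp : p ∈ A)
    (hpx : dist p x < δ) {m : ℕ} (hm : 0 < m) (hper : G^[m] p = p) : p = x := by
  by_contra hne
  have key : ∀ k, dist (G^[k + 1] p) x < dist p x := by
    intro k
    induction k with
    | zero => exact hG p hp hne hpx
    | succ k ih =>
      rw [Function.iterate_succ_apply']
      by_cases hk : G^[k + 1] p = x
      · rwa [hk, hGx, dist_self, dist_pos]
      · exact (hG _ (hGA.iterate (k + 1) hp) hk (ih.trans hpx)).trans ih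
  obtain ⟨k, rfl⟩ := Nat.exists_eq_succ_of_ne_zero hm.ne'
  exact (key k).ne (by rw [hper])

/-- Finiteness of the periodic points when they are isolated and every minimal set is a
periodic orbit. -/
lemma finite_periodic_of_isolated {W : Type*} [NormedAddCommGroup W] {g : W ≃ₜ W} {Λ : Set W}
    (hΛ : IsCompact Λ) (hgΛ : g '' Λ ⊆ Λ)
    (hmin : ∀ C ⊆ Λ, IsMinimalSet g C → IsPeriodicOrbitSet g C)
    (hiso : ∀ x ∈ Λ, ∀ n : ℕ, 0 < n → g^[n] x = x →
      ∃ δ > 0, ∀ p ∈ Λ, ∀ m : ℕ, 0 < m → g^[m] p = p → dist p x < δ → p = x) :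
    {x ∈ Λ | ∃ n : ℕ, 0 < n ∧ g^[n] x = x}.Finite := by
  by_contra hinf
  obtain ⟨y, hy, hacc⟩ :=
    Set.Infinite.exists_accPt_of_subset_isCompact hinf hΛ (sep_subset _ _)
  have hit : ∀ k, MapsTo g^[k] Λ Λ := (mapsTo_iff_image_subset.2 hgΛ).iterate
  have hKΛ : closure (range fun k => g^[k] y) ⊆ Λ :=
    closure_minimal (range_subset_iff.2 fun k => hit k hy) hΛ.isClosed
  obtain ⟨C, hCK, hC⟩ := exists_isMinimalSet_subset (g := g)
    (hΛ.of_isClosed_subset isClosed_closure hKΛ) ⟨y, subset_closure ⟨0, rfl⟩⟩ (by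
      rw [g.image_closure]
      refine closure_mono ?_
      rintro _ ⟨_, ⟨k, rfl⟩, rfl⟩
      exact ⟨k + 1, Function.iterate_succ_apply' _ _ _⟩)
  obtain ⟨x, n, hn, hper, rfl⟩ := hmin C (hCK.trans hKΛ) hC
  have hxC : x ∈ {z | ∃ k : ℕ, z = g^[k] x} := ⟨0, rfl⟩
  obtain ⟨δ, hδ, hxδ⟩ := hiso x (hKΛ (hCK hxC)) n hn hper
  obtain ⟨_, hyx, k, rfl⟩ := mem_closure_iff_nhds.1 (hCK hxC) _ (Metric.ball_mem_nhds x hδ)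
  have hU : g^[k] ⁻¹' Metric.ball x δ ∈ 𝓝 y :=
    (g.continuous.iterate k).continuousAt (Metric.isOpen_ball.mem_nhds hyx)
  have hval : ∀ p ∈ g^[k] ⁻¹' Metric.ball x δ ∩ {x ∈ Λ | ∃ n : ℕ, 0 < n ∧ g^[n] x = x},
      g^[k] p = x := by
    rintro p ⟨hpx, hpΛ, m, hm, hpm⟩
    refine hxδ _ (hit k hpΛ) m hm ?_ hpx
    rw [← Function.iterate_add_apply, add_comm, Function.iterate_add_apply, hpm]
  rw [accPt_iff_nhds] at hacc
  obtain ⟨p, hp, hpy⟩ := hacc _ hU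
  obtain ⟨q, hq, -⟩ := hacc _ (inter_mem hU (isOpen_compl_singleton.mem_nhds hpy.symm))
  exact hq.1.2 (g.injective.iterate k ((hval q ⟨hq.1.1, hq.2⟩).trans (hval p hp).symm))

variable {W : Type*} [NormedAddCommGroup W] [NormedSpace ℝ W]

lemma mem_tangentConeAt_of_hasDerivAt {h : ℝ → W} {v : W} {t₀ : ℝ} {S : Set W}
    (hh : HasDerivAt h v t₀) (hS : ∀ᶠ t in 𝓝 t₀, h t ∈ S) : v ∈ tangentConeAt ℝ S (h t₀) := by
  refine mem_tangentConeAt_of_seq (𝓝[≠] t₀) (fun t => (t - t₀)⁻¹) (fun t => h t - h t₀) ?_ ?_ ?_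
  · have : Tendsto (fun t => h t - h t₀) (𝓝 t₀) (𝓝 (h t₀ - h t₀)) :=
      hh.continuousAt.tendsto.sub_const (h t₀)
    rw [sub_self] at this
    exact this.mono_left nhdsWithin_le_nhds
  · filter_upwards [mem_nhdsWithin_of_mem_nhds hS] with t ht
    rwa [add_sub_cancel]
  · have := hasDerivAt_iff_tendsto_slope.1 hh
    exact this.congr fun t => slope_def_module _ _ _

/-- A hyperbolic periodic point of a curve is isolated among the periodic points of an
invariant subset. -/
lemma exists_isolated_of_hyperbolic [FiniteDimensional ℝ W] {g : W ≃ₜ W} {S Λ : Set W} {x : W}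
    (hg : Differentiable ℝ g) (hΛS : Λ ⊆ S) (hgΛ : g '' Λ = Λ) (hS : IsC1SubmanifoldAt 1 S x)
    (hx : x ∈ S) {n : ℕ} (hper : g^[n] x = x)
    (hyp : ∀ v ∈ tangentConeAt ℝ S x, v ≠ 0 → ‖fderiv ℝ (g^[n]) x v‖ ≠ ‖v‖) :
    ∃ δ > 0, ∀ p ∈ Λ, ∀ m : ℕ, 0 < m → g^[m] p = p → dist p x < δ → p = x := by
  obtain ⟨h, u, U, hh, hu, hU, hxU, hSU⟩ := hS.exists_section
  have hhx : h (u x) = x := (hSU x hxU).1 hx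
  have hd : HasDerivAt h (deriv h (u x)) (u x) :=
    (hh.differentiable one_ne_zero).differentiableAt.hasDerivAt
  have hF : HasFDerivAt (g^[n]) (fderiv ℝ (g^[n]) x) (h (u x)) := by
    rw [hhx]
    exact (hg.iterate n).differentiableAt.hasFDerivAt
  have hv : deriv h (u x) ≠ 0 := by
    intro hv
    have h1 := u.hasFDerivAt.comp_hasDerivAt (u x) hd
    rw [hv, map_zero, show u ∘ h = id from funext hu] at h1
    exact zero_ne_one (h1.unique (hasDerivAt_id _))
  have htan : deriv h (u x) ∈ tangentConeAt ℝ S x := by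
    have := mem_tangentConeAt_of_hasDerivAt (S := S) hd ?_
    · rwa [hhx] at this
    · filter_upwards [hd.continuousAt.preimage_mem_nhds (hU.mem_nhds (by rwa [hhx]))] with t ht
      exact (hSU _ ht).2 (by rw [hu])
  have hlift : ∀ q : W → Prop, (∀ᶠ t in 𝓝[≠] (u x), q (h t)) →
      ∀ᶠ y in 𝓝 x, y ∈ S → y ≠ x → q y := by
    intro q hq
    filter_upwards [u.continuous.continuousAt.eventually (eventually_nhdsWithin_iff.1 hq),
      hU.mem_nhds hxU] with y hy hyU hyS hyx
    have hhy := (hSU y hyU).1 hyS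
    rw [hhy] at hy
    exact hy fun hyu => hyx (by rw [← hhy, hyu, hhx])
  have hsymm : ∀ k p, g^[k] p = p → g.symm^[k] p = p := fun k p hp => by
    conv_lhs => rw [← hp]
    exact (Function.LeftInverse.iterate g.symm_apply_apply k) p
  have hmaps : MapsTo g Λ Λ := mapsTo_iff_image_subset.2 hgΛ.le
  have hmaps' : MapsTo g.symm Λ Λ := by
    intro y hy
    obtain ⟨z, hz, rfl⟩ := hgΛ.ge hy
    rwa [g.symm_apply_apply]
  rcases lt_or_gt_of_ne (hyp _ htan hv) with hlt | hlt
  · have hev : ∀ᶠ y in 𝓝 x, y ∈ S → y ≠ x → dist (g^[n] y) x < dist y x := by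
      refine hlift (fun y => dist (g^[n] y) x < dist y x) ?_
      filter_upwards [(hF.comp_hasDerivAt _ hd).eventually_norm_sub_lt hd hlt] with t ht
      simpa only [Function.comp_apply, hhx, hper, ← dist_eq_norm] using ht
    obtain ⟨δ, hδ, hball⟩ := Metric.eventually_nhds_iff.1 hev
    refine ⟨δ, hδ, fun p hp m hm hpm hpx => ?_⟩
    exact eq_of_iterate_eq_of_dist_lt hper (hmaps.iterate n)
      (fun y hy hyx hyδ => hball hyδ (hΛS hy) hyx) hp hpx hm (Function.IsPeriodicPt.iterate hpm n)
  · have hev : ∀ᶠ y in 𝓝 x, y ∈ S → y ≠ x → dist y x < dist (g^[n] y) x := by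
      refine hlift (fun y => dist y x < dist (g^[n] y) x) ?_
      filter_upwards [hd.eventually_norm_sub_lt (hF.comp_hasDerivAt _ hd) hlt] with t ht
      simpa only [Function.comp_apply, hhx, hper, ← dist_eq_norm] using ht
    have hperm := hsymm n x hper
    have hcont : Tendsto g.symm^[n] (𝓝 x) (𝓝 x) := by
      have := (g.symm.continuous.iterate n).tendsto x
      rwa [hperm] at this
    obtain ⟨δ, hδ, hball⟩ := Metric.eventually_nhds_iff.1 (hcont.eventually hev)
    refine ⟨δ, hδ, fun p hp m hm hpm hpx => ?_⟩
    refine eq_of_iterate_eq_of_dist_lt hperm (hmaps'.iterate n) (fun y hy hyx hyδ => ?_) hp hpx hm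
      (Function.IsPeriodicPt.iterate (hsymm m p hpm) n)
    have hgy : g^[n] (g.symm^[n] y) = y := (Function.LeftInverse.iterate g.apply_symm_apply n) y
    have := hball hyδ (hΛS (hmaps'.iterate n hy)) fun h => hyx (by rw [← hgy, h, hper])
    rwa [hgy] at this

end Hyperbolic

/-- Corollary `c.central1D`, dynamical part (in local coordinates on `ℝᴺ`).  `g` is a `C¹`
diffeomorphism, `Γ` a compact locally invariant one-dimensional `C¹` submanifold (finite
union of curves and circles) containing the compact invariant set `Λ`.  Then every minimal
subset of `Λ` is a periodic orbit, a periodic circle, or a Cantor set; and if moreover all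
periodic orbits of `g` in `Γ` are hyperbolic and every minimal subset of `Λ` is a Hausdorff
limit of periodic orbits, then every minimal subset of `Λ` is a periodic orbit and the set
of periodic points in `Λ` is finite. -/
theorem stmt_17 (N : ℕ)
    (g g' : EuclideanSpace ℝ (Fin N) → EuclideanSpace ℝ (Fin N))
    (hg : ContDiff ℝ 1 g) (hg' : ContDiff ℝ 1 g')
    (hinv : ∀ x, g' (g x) = x ∧ g (g' x) = x)
    (Γ Λ : Set (EuclideanSpace ℝ (Fin N)))
    (hΓ : IsCompact Γ) (hΛ : IsCompact Λ) (hΛΓ : Λ ⊆ Γ) (hΛinv : g '' Λ = Λ)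
    -- `Γ` is one-dimensional and `C¹` near `Λ`
    (hone : ∀ z ∈ Λ, IsC1SubmanifoldAt 1 Γ z)
    -- local invariance: `g(Γ) ∩ Γ` contains a neighbourhood of `Λ` in `Γ`
    (hloc : ∃ W : Set (EuclideanSpace ℝ (Fin N)), IsOpen W ∧ Λ ⊆ W ∧
      Γ ∩ W ⊆ g '' Γ ∩ Γ) :
    -- classification of minimal sets
    (∀ C ⊆ Λ, IsMinimalSet g C →
      IsPeriodicOrbitSet g C ∨ IsPeriodicCircleSet g C ∨ IsCantorSet' C) ∧
    -- hyperbolicity + approximation by periodic orbits kill non-periodic minimal sets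
    ((∀ x ∈ Γ, ∀ n : ℕ, 0 < n → g^[n] x = x →
        ∀ v ∈ tangentConeAt ℝ Γ x, v ≠ 0 → ‖fderiv ℝ (g^[n]) x v‖ ≠ ‖v‖) →
      (∀ C ⊆ Λ, IsMinimalSet g C → ∀ ε : ℝ, 0 < ε →
        ∃ x ∈ Γ, ∃ n : ℕ, 0 < n ∧ g^[n] x = x ∧
          Metric.hausdorffDist C {y | ∃ k : ℕ, y = g^[k] x} < ε) →
      (∀ C ⊆ Λ, IsMinimalSet g C → IsPeriodicOrbitSet g C) ∧
      Set.Finite {x ∈ Λ | ∃ n : ℕ, 0 < n ∧ g^[n] x = x}) := by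
  obtain ⟨V, hV, hΛV, hVΓ⟩ := hloc
  let G : EuclideanSpace ℝ (Fin N) ≃ₜ EuclideanSpace ℝ (Fin N) :=
    { toFun := g
      invFun := g'
      left_inv := fun x => (hinv x).1
      right_inv := fun x => (hinv x).2
      continuous_toFun := hg.continuous
      continuous_invFun := hg'.continuous }
  have hGS : ∀ x ∈ Γ ∩ V, G.symm x ∈ Γ := by
    intro x hx
    obtain ⟨y, hy, rfl⟩ := (hVΓ hx).1
    exact (congrArg (· ∈ Γ) (hinv y).1).mpr hy
  have hch : ∀ C ⊆ Λ, ∀ c ∈ C, ∃ β, IsLineChartAt Γ c β := fun C hC c hc =>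
    (hone c (hC hc)).exists_isLineChartAt (hΛΓ (hC hc))
  refine ⟨fun C hC hmin => IsMinimalSet.classification (g := G) hmin (hC.trans hΛΓ) (hch C hC) hV
    (hC.trans hΛV) hGS, fun hyp happ => ?_⟩
  have hper : ∀ C ⊆ Λ, IsMinimalSet g C → IsPeriodicOrbitSet g C := fun C hC hmin =>
    IsMinimalSet.isPeriodicOrbitSet_of_approx (g := G) hmin (hC.trans hΛΓ) (hch C hC) hV
      (hC.trans hΛV) hGS (happ C hC hmin)
  refine ⟨hper, finite_periodic_of_isolated (g := G) hΛ hΛinv.le hper fun x hx n hn hxn => ?_⟩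
  exact exists_isolated_of_hyperbolic (g := G) (hg.differentiable one_ne_zero) hΛΓ hΛinv
    (hone x hx) (hΛΓ hx) hxn (hyp x (hΛΓ hx) n hn hxn)
end
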